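/- arXiv:1708.06460 — 3 statements merged into one kernel-verified Lean document; each statement's English description precedes it below -/
import Mathlib

section
/- Let n, k ≥ 1 and let P ⊆ ℕ^k be a finite set of vectors that is linearly independent (over ℚ) with ‖P‖ ≤ n. Then there exists an index set I with |I| ≤ 2^k + k − 1 such that for each i ∈ I there are finite sets P_i, C_i ⊆ ℕ^k with ‖P_i‖ ≤ (2k+1) k^{k/2} n^k and ‖C_i‖ ≤ (2k+1) k^{k/2} n^k, and ℕ^k \ L(0, P) = ⋃_{i ∈ I} L(C_i, P_i). -/
/-- Maximum norm of a vector in `ℕ^k`. -/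
def vnorm {k : ℕ} (x : Fin k → ℕ) : ℕ := Finset.univ.sup x

/-- Maximum norm of a finite set of vectors in `ℕ^k` (`0` for the empty set). -/
def snorm {k : ℕ} (P : Finset (Fin k → ℕ)) : ℕ := P.sup vnorm

/-- The set `L(C,P) = { c + ∑_{x ∈ P} λ_x • x : c ∈ C, λ_x ∈ ℕ }`. -/
def LSet {k : ℕ} (C P : Finset (Fin k → ℕ)) : Set (Fin k → ℕ) :=
  {v | ∃ c ∈ C, ∃ lam : (Fin k → ℕ) → ℕ, v = c + ∑ x ∈ P, lam x • x}

/-- The linear set `L(c,P)` with a single constant vector `c`. -/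
def LSet1 {k : ℕ} (c : Fin k → ℕ) (P : Finset (Fin k → ℕ)) : Set (Fin k → ℕ) :=
  LSet {c} P

/-- A finite set of vectors of `ℕ^k` is linearly independent if its elements,
viewed as vectors in `ℚ^k`, are linearly independent. -/
def LinIndep {k : ℕ} (P : Finset (Fin k → ℕ)) : Prop :=
  LinearIndependent ℚ (fun x : P => fun i => ((x : Fin k → ℕ) i : ℚ))


lemma hadamard_bound (k n : ℕ) (M : Matrix (Fin k) (Fin k) ℤ) (hM : ∀ i j, |M i j| ≤ n) :
    ((|M.det| : ℤ) : ℝ) ≤ (k : ℝ) ^ ((k : ℝ) / 2) * (n : ℝ) ^ k := by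
  let b := EuclideanSpace.basisFun (Fin k) ℝ
  have : Fact (Module.finrank ℝ (EuclideanSpace ℝ (Fin k)) = k) := ⟨by simp⟩
  let o := b.toBasis.orientation
  let v : Fin k → EuclideanSpace ℝ (Fin k) := fun i => WithLp.toLp 2 (fun j => (M i j : ℝ))
  have h1 := o.abs_volumeForm_apply_le v
  rw [o.volumeForm_robust' b] at h1
  have h2 : b.toBasis.det v = ((M.det : ℤ) : ℝ) := by
    rw [Module.Basis.det_apply, Int.cast_det, ← Matrix.det_transpose]
    congr 1
  rw [h2] at h1
  have h3 : ∀ i, ‖v i‖ ≤ Real.sqrt k * n := by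
    intro i
    rw [EuclideanSpace.norm_eq]
    have : Real.sqrt k * n = Real.sqrt (k * (n:ℝ)^2) := by
      rw [Real.sqrt_mul (by positivity), Real.sqrt_sq (by positivity)]
    rw [this]
    apply Real.sqrt_le_sqrt
    calc _ ≤ ∑ j : Fin k, (n:ℝ)^2 := by
          apply Finset.sum_le_sum
          intro j _
          have : |(M i j : ℝ)| ≤ n := by exact_mod_cast hM i j
          simp only [v, Real.norm_eq_abs]
          gcongr
      _ = _ := by simp
  calc ((|M.det| : ℤ) : ℝ) = |(M.det : ℝ)| := by push_cast; rfl
    _ ≤ _ := h1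
    _ ≤ ∏ i : Fin k, Real.sqrt k * n := Finset.prod_le_prod (fun _ _ => norm_nonneg _) (fun i _ => h3 i)
    _ = _ := by
      rw [Finset.prod_const, Finset.card_univ, Fintype.card_fin, mul_pow, Real.sqrt_eq_rpow, ← Real.rpow_natCast, ← Real.rpow_mul (by positivity)]
      congr 2; ring

lemma basis_between (k : ℕ) (s t : Set (Fin k → ℚ)) (hs : LinearIndepOn ℚ id s) (hst : s ⊆ t)
    (ht : Submodule.span ℚ t = ⊤) :
    ∃ B : Module.Basis (Fin k) ℚ (Fin k → ℚ), (∀ j, B j ∈ t) ∧ s ⊆ Set.range B := by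
  let B := Module.Basis.extendLe hs hst ht.ge
  have := Module.Finite.finite_basis B
  have := Fintype.ofFinite (hs.extend hst)
  have hc : Fintype.card (hs.extend hst) = k := by
    rw [← Module.finrank_eq_card_basis B]; simp
  let e := Fintype.equivFinOfCardEq hc
  refine ⟨B.reindex e, ?_, ?_⟩
  · intro j
    rw [Module.Basis.reindex_apply]
    apply Module.Basis.extendLe_subset hs hst ht.ge
    exact ⟨_, rfl⟩
  · rw [Module.Basis.range_reindex]
    exact Module.Basis.subset_extendLe hs hst ht.ge

open Matrix in
lemma span_top_of_sep (k : ℕ) (t : Set (Fin k → ℚ)) (h : ∀ μ : Fin k → ℚ, (∀ g ∈ t, g ⬝ᵥ μ = 0) → μ = 0) :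
    Submodule.span ℚ t = ⊤ := by
  by_contra hne
  obtain ⟨f, hf, hle⟩ := Submodule.exists_le_ker_of_lt_top _ (lt_top_iff_ne_top.2 hne)
  apply hf
  have hrep : ∀ g, f g = g ⬝ᵥ (fun i => f (Pi.single i 1)) := by
    intro g
    conv_lhs => rw [pi_eq_sum_univ' g]
    simp [dotProduct, map_sum]
  have := h (fun i => f (Pi.single i 1)) (by
    intro g hg
    rw [← hrep]
    exact hle (Submodule.subset_span hg))
  ext i
  simpa using congrFun this i

def Conf {ι W : Type*} [AddCommGroup W] [Module ℚ W] (φ : ι → W →ₗ[ℚ] ℚ) (e μ : W) : Prop :=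
  ∀ a, (0 ≤ φ a μ → 0 ≤ φ a e) ∧ (φ a μ ≤ 0 → φ a e ≤ 0)

def IntBdd {ι W : Type*} [AddCommGroup W] [Module ℚ W] (φ : ι → W →ₗ[ℚ] ℚ) (H : ℕ) (e : W) : Prop :=
  ∀ a, ∃ z : ℤ, φ a e = z ∧ |z| ≤ H

def Elem {ι W : Type*} [AddCommGroup W] [Module ℚ W] (φ : ι → W →ₗ[ℚ] ℚ) (e : W) : Prop :=
  ∀ e', e' ≠ 0 → (∀ a, φ a e = 0 → φ a e' = 0) → ∀ a, φ a e' = 0 → φ a e = 0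

section conf
variable {ι W : Type*} [AddCommGroup W] [Module ℚ W] (φ : ι → W →ₗ[ℚ] ℚ)

lemma Conf.zero {φ : ι → W →ₗ[ℚ] ℚ} {e μ : W} (h : Conf φ e μ) (a : ι) (h0 : φ a μ = 0) : φ a e = 0 :=
  le_antisymm ((h a).2 h0.le) ((h a).1 h0.ge)

variable [Fintype ι]

lemma conf_step (μ y : W) (hs : ∀ a, φ a μ = 0 → φ a y = 0) (hp : ∃ a, 0 < φ a μ * φ a y) :
    ∃ t : ℚ, 0 < t ∧ Conf φ (μ - t • y) μ ∧
      (Finset.univ.filter (fun a => φ a (μ - t • y) ≠ 0)).card <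
        (Finset.univ.filter (fun a => φ a μ ≠ 0)).card := by
  classical
  obtain ⟨a1, ha1⟩ := hp
  obtain ⟨a0, ha0, hmin⟩ := Finset.exists_min_image (Finset.univ.filter (fun a => 0 < φ a μ * φ a y))
    (fun a => φ a μ / φ a y) ⟨a1, by simpa using ha1⟩
  simp only [Finset.mem_filter, Finset.mem_univ, true_and] at ha0 hmin
  have hy0 : φ a0 y ≠ 0 := by rintro h; simp [h] at ha0
  have hx0 : φ a0 μ ≠ 0 := by rintro h; simp [h] at ha0
  have ht : 0 < φ a0 μ / φ a0 y := by
    rcases pos_and_pos_or_neg_and_neg_of_mul_pos ha0 with ⟨h1, h2⟩ | ⟨h1, h2⟩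
    · exact div_pos h1 h2
    · exact div_pos_of_neg_of_neg h1 h2
  have hc : Conf φ (μ - (φ a0 μ / φ a0 y) • y) μ := by
    intro a
    rw [map_sub, map_smul, smul_eq_mul]
    generalize φ a0 μ / φ a0 y = t at *
    constructor
    · intro hx
      rcases le_or_gt (φ a y) 0 with hy | hy
      · nlinarith
      · have hx' : 0 < φ a μ := lt_of_le_of_ne hx (fun h => hy.ne' (hs a h.symm))
        have := hmin a (mul_pos hx' hy)
        rw [le_div_iff₀ hy] at this
        linarith
    · intro hx
      rcases le_or_gt 0 (φ a y) with hy | hy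
      · nlinarith
      · have hx' : φ a μ < 0 := lt_of_le_of_ne hx (fun h => hy.ne (hs a h))
        have := hmin a (mul_pos_of_neg_of_neg hx' hy)
        rw [le_div_iff_of_neg hy] at this
        linarith
  refine ⟨_, ht, hc, ?_⟩
  apply Finset.card_lt_card
  rw [Finset.ssubset_iff_of_subset]
  · refine ⟨a0, by simpa using hx0, ?_⟩
    simp [div_mul_cancel₀ _ hy0]
  · intro a
    simp only [Finset.mem_filter, Finset.mem_univ, true_and]
    exact mt (hc.zero a)

lemma exists_elem (hsep : ∀ μ, (∀ a, φ a μ = 0) → μ = 0) (s : ℕ) : ∀ μ : W, μ ≠ 0 →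
    (Finset.univ.filter (fun a => φ a μ ≠ 0)).card ≤ s → ∃ e, e ≠ 0 ∧ Conf φ e μ ∧ Elem φ e := by
  induction s with
  | zero =>
    intro μ h0 h
    exfalso
    apply h0
    apply hsep
    simpa [Finset.filter_eq_empty_iff] using h
  | succ s ih =>
    intro μ h0 h
    by_cases hE : Elem φ μ
    · exact ⟨μ, h0, fun a => ⟨id, id⟩, hE⟩
    unfold Elem at hE
    push Not at hE
    obtain ⟨y, hy0, hys, b, hb1, hb2⟩ := hE
    have key : ∀ y : W, (∀ a, φ a μ = 0 → φ a y = 0) → φ b y = 0 → (∃ a, 0 < φ a μ * φ a y) →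
        ∃ e, e ≠ 0 ∧ Conf φ e μ ∧ Elem φ e := by
      intro y hys hb1 hp
      obtain ⟨t, ht, hc, hlt⟩ := conf_step φ μ y hys hp
      obtain ⟨e, he0, hec, hee⟩ := ih (μ - t • y) (by
        intro hz
        have : φ b (μ - t • y) = 0 := by rw [hz, map_zero]
        simp [hb1, hb2] at this) (by omega)
      exact ⟨e, he0, fun a => ⟨fun h => (hec a).1 ((hc a).1 h), fun h => (hec a).2 ((hc a).2 h)⟩, hee⟩
    have : ∃ a, φ a y ≠ 0 := by
      by_contra hne
      push Not at hne
      exact hy0 (hsep y hne)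
    obtain ⟨a, ha⟩ := this
    have hma : φ a μ ≠ 0 := fun h => ha (hys a h)
    rcases lt_or_gt_of_ne (mul_ne_zero hma ha) with hl | hl
    · apply key (-y)
      · intro a h; simp [hys a h]
      · simp [hb1]
      · exact ⟨a, by simpa using hl⟩
    · exact key y hys hb1 ⟨a, hl⟩

lemma exists_decomp (hsep : ∀ μ, (∀ a, φ a μ = 0) → μ = 0) (H : ℕ)
    (hB : ∀ μ : W, μ ≠ 0 → ∃ e, e ≠ 0 ∧ Conf φ e μ ∧ IntBdd φ H e) (s : ℕ) : ∀ μ : W,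
    (Finset.univ.filter (fun a => φ a μ ≠ 0)).card ≤ s →
    ∃ μ' q, μ = μ' + q ∧ q ∈ AddSubmonoid.closure {e | Conf φ e μ ∧ IntBdd φ H e} ∧
      ∀ a, |φ a μ'| ≤ s * H ∧ (0 < φ a μ → 0 < φ a μ') ∧ (φ a μ < 0 → φ a μ' < 0) ∧
        (φ a μ = 0 → φ a μ' = 0) := by
  induction s with
  | zero =>
    intro μ h
    have h : ∀ a, φ a μ = 0 := by
      simpa [Finset.filter_eq_empty_iff] using h
    refine ⟨μ, 0, by simp, zero_mem _, fun a => ⟨by simp [h], id, id, id⟩⟩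
  | succ s ih =>
    intro μ h
    by_cases h0 : μ = 0
    · subst h0
      refine ⟨0, 0, by simp, zero_mem _, fun a => ⟨by rw [map_zero, abs_zero]; positivity, id, id, id⟩⟩
    obtain ⟨e, he0, hec, heB⟩ := hB μ h0
    have : ∃ a, φ a e ≠ 0 := by
      by_contra hne
      push Not at hne
      exact he0 (hsep e hne)
    obtain ⟨a, ha⟩ := this
    have hma : φ a μ ≠ 0 := fun h => ha (hec.zero a h)
    have hp : 0 < φ a μ * φ a e := by
      rcases lt_or_gt_of_ne hma with hl | hl
      · exact mul_pos_of_neg_of_neg hl (lt_of_le_of_ne ((hec a).2 hl.le) ha)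
      · exact mul_pos hl (lt_of_le_of_ne ((hec a).1 hl.le) ha.symm)
    obtain ⟨t, ht, hc, hlt⟩ := conf_step φ μ e hec.zero ⟨a, hp⟩
    obtain ⟨μ', q, heq, hq, hμ'⟩ := ih (μ - t • e) (by omega)
    obtain ⟨m, hm⟩ : ∃ m : ℕ, (⌈t⌉₊ = m + 1) :=
      Nat.exists_eq_add_one.2 (Nat.ceil_pos.2 ht)
    have hm1 : (m : ℚ) < t := by
      have : m < ⌈t⌉₊ := by omega
      exact Nat.lt_ceil.1 this
    have hm2 : t ≤ m + 1 := by
      have := Nat.le_ceil t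
      rw [hm] at this
      exact_mod_cast this
    refine ⟨μ' + (t - m) • e, q + m • e, ?_, ?_, ?_⟩
    · have : μ = (μ' + q) + t • e := by rw [← heq]; abel
      rw [this, sub_smul, Nat.cast_smul_eq_nsmul]
      abel
    · have hmem : e ∈ AddSubmonoid.closure {e | Conf φ e μ ∧ IntBdd φ H e} :=
        AddSubmonoid.subset_closure ⟨hec, heB⟩
      refine add_mem (AddSubmonoid.closure_mono ?_ hq) (nsmul_mem hmem m)
      rintro x ⟨hx1, hx2⟩
      exact ⟨fun a => ⟨fun h => (hx1 a).1 ((hc a).1 h), fun h => (hx1 a).2 ((hc a).2 h)⟩, hx2⟩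
    · intro a
      obtain ⟨i1, i2, i3, i4⟩ := hμ' a
      have hca := hc a
      have heca := hec a
      obtain ⟨z, hz, hzH⟩ := heB a
      have hzH' : |φ a e| ≤ H := by rw [hz]; exact_mod_cast hzH
      rw [map_sub, map_smul, smul_eq_mul] at i2 i3 i4 hca
      rw [map_add, map_smul, smul_eq_mul]
      have hr0 : 0 < t - m := by linarith
      have hr1 : t - m ≤ 1 := by linarith
      generalize t - m = r at *
      generalize φ a e = x at *
      generalize φ a μ = w at *
      generalize φ a μ' = w' at *
      refine ⟨?_, ?_, ?_, ?_⟩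
      · have : |r * x| ≤ H := by
          rw [abs_mul, abs_of_pos hr0]
          nlinarith [abs_nonneg x]
        push_cast
        linarith [abs_add_le w' (r * x)]
      · intro hw
        have h1 := hca.1 hw.le
        have h2 := heca.1 hw.le
        rcases h2.eq_or_lt with h3 | h3
        · subst h3; simp at *; exact i2 hw
        · have : 0 < r * x := mul_pos hr0 h3
          rcases h1.eq_or_lt with h4 | h4
          · have := i4 h4.symm; linarith
          · have := i2 h4; linarith
      · intro hw
        have h1 := hca.2 hw.le
        have h2 := heca.2 hw.le
        rcases h2.eq_or_lt with h3 | h3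
        · subst h3; simp at *; exact i3 hw
        · have : r * x < 0 := mul_neg_of_pos_of_neg hr0 h3
          rcases h1.eq_or_lt with h4 | h4
          · have := i4 h4; linarith
          · have := i3 h4; linarith
      · intro hw
        have h3 : x = 0 := le_antisymm (heca.2 hw.le) (heca.1 hw.ge)
        subst h3
        simp at *
        exact i4 hw

end conf

open Matrix in
lemma elem_bdd {k : ℕ} {ι : Type*} [Fintype ι] (F : ι → Fin k → ℤ) (φ : ι → (Fin k → ℚ) →ₗ[ℚ] ℚ)
    (hφ : ∀ a μ, φ a μ = (fun j => (F a j : ℚ)) ⬝ᵥ μ) (n H : ℕ) (hF : ∀ a j, |F a j| ≤ n)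
    (hH : ∀ M : Matrix (Fin k) (Fin k) ℤ, (∀ i j, |M i j| ≤ n) → |M.det| ≤ H)
    (hsep : ∀ μ, (∀ a, φ a μ = 0) → μ = 0) (e : Fin k → ℚ) (he0 : e ≠ 0) (hE : Elem φ e) :
    ∃ c : ℚ, c ≠ 0 ∧ IntBdd φ H (c • e) := by
  classical
  obtain ⟨a0, ha0⟩ : ∃ a, φ a e ≠ 0 := by
    by_contra hne
    push Not at hne
    exact he0 (hsep e hne)
  let G : ι → Fin k → ℚ := fun a j => (F a j : ℚ)
  have hG : ∀ a μ, φ a μ = G a ⬝ᵥ μ := hφ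
  let t : Set (Fin k → ℚ) := G '' {a | φ a e = 0 ∨ a = a0}
  have ht : Submodule.span ℚ t = ⊤ := by
    apply span_top_of_sep
    intro μ hμ
    by_contra hne
    apply ha0
    refine hE μ hne ?_ a0 ?_
    · intro a ha
      rw [hG]; exact hμ _ ⟨a, Or.inl ha, rfl⟩
    · rw [hG]; exact hμ _ ⟨a0, Or.inr rfl, rfl⟩
  have hg0 : G a0 ≠ 0 := by
    intro h; apply ha0; rw [hG, h, zero_dotProduct]
  obtain ⟨B, hB1, hB2⟩ := basis_between k {G a0} t (LinearIndepOn.singleton hg0)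
    (by rintro _ rfl; exact ⟨a0, Or.inr rfl, rfl⟩) ht
  obtain ⟨i0, hi0⟩ := hB2 rfl
  choose r hr hrB using hB1
  let M : Matrix (Fin k) (Fin k) ℤ := fun i => F (r i)
  let MQ : Matrix (Fin k) (Fin k) ℚ := fun i => B i
  have hMQ : ∀ i j, MQ i j = M i j := by
    intro i j
    change B i j = _
    rw [← hrB i]
  have hMQe : MQ *ᵥ e = Pi.single i0 (φ a0 e) := by
    ext i
    change B i ⬝ᵥ e = _
    by_cases h : i = i0
    · subst h
      rw [hi0, Pi.single_eq_same, hG]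
    · rw [Pi.single_eq_of_ne h, ← hrB i, ← hG]
      rcases hr i with h' | h'
      · exact h'
      · exfalso; apply h; apply B.injective; rw [hi0, ← hrB i, h']
  have hdet : MQ.det ≠ 0 := by
    have h1 : IsUnit MQ := by
      rw [← Matrix.linearIndependent_rows_iff_isUnit]
      exact B.linearIndependent
    exact ((Matrix.isUnit_iff_isUnit_det _).1 h1).ne_zero
  have key : ∀ a, MQ.det * φ a e = φ a0 e * (MQ.updateRow i0 (G a)).det := by
    intro a
    have h1 : MQ.det • e = MQ.adjugate *ᵥ Pi.single i0 (φ a0 e) := by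
      rw [← hMQe, mulVec_mulVec, adjugate_mul, smul_mulVec, one_mulVec]
    have h2 : MQ.det * φ a e = G a ⬝ᵥ (MQ.det • e) := by
      rw [dotProduct_smul, hG, smul_eq_mul]
    rw [h2, h1, ← cramer_transpose_apply, cramer_eq_adjugate_mulVec, mulVec_single, ← adjugate_transpose]
    simp only [dotProduct, mulVec, Finset.mul_sum]
    apply Finset.sum_congr rfl
    intro j _
    simp [MulOpposite.smul_eq_mul_unop]
    ring
  refine ⟨MQ.det / φ a0 e, div_ne_zero hdet ha0, ?_⟩
  intro a
  refine ⟨(M.updateRow i0 (F a)).det, ?_, ?_⟩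
  · rw [map_smul, smul_eq_mul, Int.cast_det, div_mul_eq_mul_div, key, mul_div_cancel_left₀ _ ha0]
    congr 1
    ext i j
    by_cases h : i = i0
    · subst h; simp [G]
    · simp [updateRow_ne h, hMQ]
  · apply hH
    intro i j
    by_cases h : i = i0
    · subst h; simpa using hF a j
    · simpa [updateRow_ne h] using hF _ j

lemma exists_bdd {k : ℕ} {ι : Type*} [Fintype ι] (F : ι → Fin k → ℤ) (φ : ι → (Fin k → ℚ) →ₗ[ℚ] ℚ)
    (hφ : ∀ a μ, φ a μ = (fun j => (F a j : ℚ)) ⬝ᵥ μ) (n H : ℕ) (hF : ∀ a j, |F a j| ≤ n)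
    (hH : ∀ M : Matrix (Fin k) (Fin k) ℤ, (∀ i j, |M i j| ≤ n) → |M.det| ≤ H)
    (hsep : ∀ μ, (∀ a, φ a μ = 0) → μ = 0) (μ : Fin k → ℚ) (h0 : μ ≠ 0) :
    ∃ e, e ≠ 0 ∧ Conf φ e μ ∧ IntBdd φ H e := by
  obtain ⟨e, he0, hc, hE⟩ := exists_elem φ hsep _ μ h0 le_rfl
  obtain ⟨c, hc0, hb⟩ := elem_bdd F φ hφ n H hF hH hsep e he0 hE
  refine ⟨|c| • e, smul_ne_zero (abs_ne_zero.2 hc0) he0, ?_, ?_⟩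
  · intro a
    rw [map_smul, smul_eq_mul]
    exact ⟨fun h => mul_nonneg (abs_nonneg _) ((hc a).1 h),
      fun h => mul_nonpos_of_nonneg_of_nonpos (abs_nonneg _) ((hc a).2 h)⟩
  · intro a
    obtain ⟨z, hz, hzH⟩ := hb a
    rcases abs_choice c with h | h
    · exact ⟨z, by rw [h, hz], hzH⟩
    · refine ⟨-z, by rw [h, neg_smul, map_neg, hz]; simp, by rwa [abs_neg]⟩

lemma mem_LSet {k : ℕ} (C P : Finset (Fin k → ℕ)) (v : Fin k → ℕ) :
    v ∈ LSet C P ↔ ∃ c ∈ C, ∃ q ∈ AddSubmonoid.closure (P : Set (Fin k → ℕ)), v = c + q := by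
  constructor
  · rintro ⟨c, hc, lam, h⟩
    exact ⟨c, hc, _, sum_mem fun x hx => nsmul_mem (AddSubmonoid.subset_closure hx) _, h⟩
  · rintro ⟨c, hc, q, hq, h⟩
    obtain ⟨f, -, hf⟩ := AddSubmonoid.mem_closure_finset.1 hq
    exact ⟨c, hc, f, by rw [h, hf]⟩

lemma mem_LSet1_zero {k : ℕ} (P : Finset (Fin k → ℕ)) (v : Fin k → ℕ) :
    v ∈ LSet1 0 P ↔ v ∈ AddSubmonoid.closure (P : Set (Fin k → ℕ)) := by
  rw [LSet1, mem_LSet]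
  simp

lemma exists_b (n k : ℕ) (hn : 1 ≤ n) (P : Finset (Fin k → ℕ)) (hind : LinIndep P) (hPn : snorm P ≤ n) :
    ∃ (b : Fin k → Fin k → ℕ) (coef : (Fin k → ℕ) → Fin k → ℚ),
      (∀ j i, b j i ≤ n) ∧ (∀ x ∈ P, ∃ j, b j = x) ∧
      (∀ v e, coef v = e ↔ ∀ i, (v i : ℚ) = ∑ j, (b j i : ℚ) * e j) := by
  let cst : (Fin k → ℕ) → Fin k → ℚ := fun v i => (v i : ℚ)
  have hcst : Function.Injective cst := by
    intro x y h
    ext i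
    have : (x i : ℚ) = y i := congrFun h i
    exact_mod_cast this
  have hs : LinearIndepOn ℚ id (cst '' P) := by
    have := LinearIndependent.linearIndepOn_id hind
    convert this using 1
    ext x
    simp [cst]
  obtain ⟨B, hB1, hB2⟩ := basis_between k (cst '' P) (cst '' {v | ∀ i, v i ≤ n}) hs
    (by
      apply Set.image_mono
      intro x hx i
      calc x i ≤ vnorm x := Finset.le_sup (f := x) (Finset.mem_univ i)
        _ ≤ snorm P := Finset.le_sup (f := vnorm) hx
        _ ≤ n := hPn)
    (by
      apply span_top_of_sep
      intro μ hμ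
      ext i
      have := hμ (cst (Pi.single i 1)) ⟨Pi.single i 1, by
        intro j
        by_cases h : j = i
        · subst h; simpa using hn
        · simp [Pi.single_eq_of_ne h], rfl⟩
      have h2 : cst (Pi.single i 1) = Pi.single i 1 := by
        ext j
        by_cases h : j = i
        · subst h; simp [cst]
        · simp [cst, Pi.single_eq_of_ne h]
      rw [h2] at this
      simpa using this)
  choose b hb hbB using hB1
  refine ⟨b, fun v => B.equivFun (cst v), hb, ?_, ?_⟩
  · intro x hx
    obtain ⟨j, hj⟩ := hB2 ⟨x, hx, rfl⟩
    exact ⟨j, hcst (by rw [hbB, hj])⟩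
  · intro v e
    rw [← LinearEquiv.eq_symm_apply, Module.Basis.equivFun_symm_apply, funext_iff]
    apply forall_congr'
    intro i
    rw [Finset.sum_apply]
    simp only [cst, Pi.smul_apply, smul_eq_mul, ← hbB]
    simp only [mul_comm]

section final
variable {k : ℕ} {b : Fin k → Fin k → ℕ} {coef : (Fin k → ℕ) → Fin k → ℚ}

lemma coef_spec
    (hch : ∀ v e, coef v = e ↔ ∀ i, (v i : ℚ) = ∑ j, (b j i : ℚ) * e j)
    (v : Fin k → ℕ) (i : Fin k) : (v i : ℚ) = ∑ j, (b j i : ℚ) * coef v j :=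
  (hch v _).1 rfl i

lemma coef_add
    (hch : ∀ v e, coef v = e ↔ ∀ i, (v i : ℚ) = ∑ j, (b j i : ℚ) * e j)
    (x y : Fin k → ℕ) : coef (x + y) = coef x + coef y := by
  rw [hch]
  intro i
  simp [mul_add, Finset.sum_add_distrib, ← coef_spec hch]

lemma coef_zero
    (hch : ∀ v e, coef v = e ↔ ∀ i, (v i : ℚ) = ∑ j, (b j i : ℚ) * e j)
    : coef 0 = 0 := by
  rw [hch]; simp

lemma coef_b
    (hch : ∀ v e, coef v = e ↔ ∀ i, (v i : ℚ) = ∑ j, (b j i : ℚ) * e j)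
    (j : Fin k) : coef (b j) = Pi.single j 1 := by
  rw [hch]
  intro i
  simp [Pi.single_apply]

lemma coef_sum
    (hch : ∀ v e, coef v = e ↔ ∀ i, (v i : ℚ) = ∑ j, (b j i : ℚ) * e j)
    (m : Fin k → ℕ) : coef (∑ j, m j • b j) = fun j => (m j : ℚ) := by
  rw [hch]
  intro i
  simp [mul_comm]

lemma coef_inj
    (hch : ∀ v e, coef v = e ↔ ∀ i, (v i : ℚ) = ∑ j, (b j i : ℚ) * e j)
    {x y : Fin k → ℕ} (h : coef x = coef y) : x = y := by
  ext i
  have := coef_spec hch x i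
  rw [h, ← coef_spec hch y i] at this
  exact_mod_cast this

lemma mem_L_iff
    (hch : ∀ v e, coef v = e ↔ ∀ i, (v i : ℚ) = ∑ j, (b j i : ℚ) * e j)
    (P : Finset (Fin k → ℕ)) (hP : ∀ x ∈ P, ∃ j, b j = x) (v : Fin k → ℕ) :
    v ∈ LSet1 0 P ↔ (∀ j, ∃ m : ℕ, coef v j = m) ∧ ∀ j, b j ∉ P → coef v j = 0 := by
  rw [mem_LSet1_zero]
  constructor
  · intro h
    induction h using AddSubmonoid.closure_induction with
    | mem x hx =>
      obtain ⟨j, rfl⟩ := hP x hx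
      rw [coef_b hch]
      constructor
      · intro i
        by_cases h : i = j
        · subst h; exact ⟨1, by simp⟩
        · exact ⟨0, by simp [Pi.single_eq_of_ne h]⟩
      · intro i hi
        have h : i ≠ j := by rintro rfl; exact hi hx
        rw [Pi.single_eq_of_ne h]
    | zero => rw [coef_zero hch]; exact ⟨fun j => ⟨0, by simp⟩, fun j _ => rfl⟩
    | add x y _ _ hx hy =>
      rw [coef_add hch]
      constructor
      · intro j
        obtain ⟨m1, h1⟩ := hx.1 j
        obtain ⟨m2, h2⟩ := hy.1 j
        exact ⟨m1 + m2, by simp [h1, h2]⟩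
      · intro j hj
        simp [hx.2 j hj, hy.2 j hj]
  · rintro ⟨h1, h2⟩
    choose m hm using h1
    have : v = ∑ j, m j • b j := by
      apply coef_inj hch
      rw [coef_sum hch]
      ext j
      exact hm j
    rw [this]
    apply sum_mem
    intro j _
    by_cases hj : b j ∈ P
    · exact nsmul_mem (AddSubmonoid.subset_closure hj) _
    · have : m j = 0 := by
        have := h2 j hj
        rw [hm j] at this
        exact_mod_cast this
      rw [this, zero_smul]
      exact zero_mem _

lemma coef_sub
    (hch : ∀ v e, coef v = e ↔ ∀ i, (v i : ℚ) = ∑ j, (b j i : ℚ) * e j)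
    {x y : Fin k → ℕ} (h : y ≤ x) : coef (x - y) = coef x - coef y := by
  have h1 := coef_add hch (x - y) y
  rw [tsub_add_cancel_of_le h] at h1
  rw [h1, add_sub_cancel_right]

/-- All coefficients nonnegative. -/
lemma case_empty
    (hch : ∀ v e, coef v = e ↔ ∀ i, (v i : ℚ) = ∑ j, (b j i : ℚ) * e j)
    (P : Finset (Fin k → ℕ)) (hP : ∀ x ∈ P, ∃ j, b j = x) (n N : ℕ)
    (hbn : ∀ j i, b j i ≤ n) (hN1 : n ≤ N) (hN : k * n ≤ N) (v : Fin k → ℕ) (hv : v ∉ LSet1 0 P)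
    (hv0 : ∀ j, 0 ≤ coef v j) :
    ∃ c, (∀ i, c i ≤ N) ∧ (∀ j, 0 ≤ coef c j) ∧ c ∉ LSet1 0 P ∧
      ∃ q ∈ AddSubmonoid.closure (Set.range b), v = c + q := by
  let m : Fin k → ℕ := fun j => ⌊coef v j⌋₊
  have hm1 : ∀ j, (m j : ℚ) ≤ coef v j := fun j => Nat.floor_le (hv0 j)
  have hm2 : ∀ j, coef v j < m j + 1 := fun j => Nat.lt_floor_add_one _
  let q := ∑ j, m j • b j
  have hqc : coef q = fun j => (m j : ℚ) := coef_sum hch m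
  have hqv : q ≤ v := by
    intro i
    have : (q i : ℚ) ≤ v i := by
      rw [coef_spec hch q i, coef_spec hch v i, hqc]
      apply Finset.sum_le_sum
      intro j _
      exact mul_le_mul_of_nonneg_left (hm1 j) (by positivity)
    exact_mod_cast this
  have hc := coef_sub hch hqv
  have hcj : ∀ j, coef (v - q) j = coef v j - m j := by
    intro j; rw [hc, hqc]; rfl
  by_cases hcL : v - q ∈ LSet1 0 P
  · rw [mem_L_iff hch P hP] at hcL hv
    have hint : ∀ j, coef v j = m j := by
      intro j
      obtain ⟨l, hl⟩ := hcL.1 j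
      have h1 := hcj j
      rw [hl] at h1
      have : (l : ℚ) < 1 := by linarith [hm2 j]
      have : l = 0 := by
        have : l < 1 := by exact_mod_cast this
        omega
      subst this
      push_cast at h1
      linarith
    have : ∃ j, b j ∉ P ∧ coef v j ≠ 0 := by
      by_contra hne
      push Not at hne
      exact hv ⟨fun j => ⟨m j, hint j⟩, hne⟩
    obtain ⟨j, hj, hjv⟩ := this
    refine ⟨b j, fun i => (hbn j i).trans hN1, ?_, ?_, ?_⟩
    · intro i
      rw [coef_b hch, Pi.single_apply]
      split_ifs <;> simp
    · rw [mem_L_iff hch P hP]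
      rintro ⟨-, h⟩
      have := h j hj
      rw [coef_b hch] at this
      simp at this
    · have hmj : m j ≠ 0 := by
        intro h; apply hjv; rw [hint, h]; simp
      obtain ⟨l, hl⟩ := Nat.exists_eq_succ_of_ne_zero hmj
      have hvq : v = q := by
        apply coef_inj hch
        rw [hqc]; ext j; exact hint j
      refine ⟨l • b j + ∑ i ∈ Finset.univ.erase j, m i • b i, ?_, ?_⟩
      · exact add_mem (nsmul_mem (AddSubmonoid.subset_closure (Set.mem_range_self j)) _)
          (sum_mem fun i _ => nsmul_mem (AddSubmonoid.subset_closure (Set.mem_range_self i)) _)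
      · rw [hvq]
        change ∑ j, m j • b j = _
        rw [← Finset.add_sum_erase _ _ (Finset.mem_univ j), hl, Nat.succ_eq_add_one, add_smul, one_smul]
        abel
  · refine ⟨v - q, ?_, ?_, hcL, q, ?_, ?_⟩
    · intro i
      refine le_trans ?_ hN
      have : ((v - q) i : ℚ) ≤ ((k * n : ℕ) : ℚ) := by
        calc (((v - q) i : ℕ) : ℚ) = ∑ j, (b j i : ℚ) * coef (v - q) j := coef_spec hch _ i
          _ ≤ ∑ j : Fin k, (n : ℚ) := by
            apply Finset.sum_le_sum
            intro j _
            have h1 : (b j i : ℚ) ≤ n := by exact_mod_cast hbn j i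
            have h2 := hcj j
            have h3 := hm1 j
            have h4 := hm2 j
            have h5 : (0:ℚ) ≤ b j i := by positivity
            rw [h2]
            nlinarith
          _ = _ := by simp
      exact_mod_cast this
    · intro j; rw [hcj]; linarith [hm1 j]
    · exact sum_mem fun i _ => nsmul_mem (AddSubmonoid.subset_closure (Set.mem_range_self i)) _
    · rw [tsub_add_cancel_of_le hqv]

/-- Some coefficients negative. -/
lemma case_neg
    (hch : ∀ v e, coef v = e ↔ ∀ i, (v i : ℚ) = ∑ j, (b j i : ℚ) * e j)
    (n H : ℕ) (hn : 1 ≤ n) (hbn : ∀ j i, b j i ≤ n)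
    (hH : ∀ M : Matrix (Fin k) (Fin k) ℤ, (∀ i j, |M i j| ≤ n) → |M.det| ≤ H)
    (v : Fin k → ℕ) :
    ∃ c, (∀ i, c i ≤ 2 * k * H) ∧
      (∀ j, (coef v j < 0 → coef c j < 0) ∧ (0 ≤ coef v j → 0 ≤ coef c j)) ∧
      ∃ q ∈ AddSubmonoid.closure {r : Fin k → ℕ | (∀ i, r i ≤ H) ∧
        ∀ j, (coef v j < 0 → coef r j ≤ 0) ∧ (0 ≤ coef v j → 0 ≤ coef r j)}, v = c + q := by
  let F : Fin k ⊕ Fin k → Fin k → ℤ := Sum.elim (fun j => Pi.single j 1) (fun i j => (b j i : ℤ))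
  let φ : Fin k ⊕ Fin k → (Fin k → ℚ) →ₗ[ℚ] ℚ := fun a =>
    { toFun := fun μ => (fun j => (F a j : ℚ)) ⬝ᵥ μ
      map_add' := fun x y => dotProduct_add _ x y
      map_smul' := fun c x => dotProduct_smul c _ x }
  have hφ : ∀ a μ, φ a μ = (fun j => (F a j : ℚ)) ⬝ᵥ μ := fun a μ => rfl
  have hl : ∀ j μ, φ (Sum.inl j) μ = μ j := by
    intro j μ
    rw [hφ]
    simp [F, dotProduct, Pi.single_apply]
  have hr : ∀ i μ, φ (Sum.inr i) μ = ∑ j, (b j i : ℚ) * μ j := by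
    intro i μ
    rw [hφ]
    simp [F, dotProduct]
  have hF : ∀ a j, |F a j| ≤ n := by
    rintro (i | i) j
    · simp only [F, Sum.elim_inl, Pi.single_apply]
      split_ifs
      · simpa using hn
      · simp
    · simp only [F, Sum.elim_inr, Nat.abs_cast]
      exact_mod_cast hbn j i
  have hsep : ∀ μ, (∀ a, φ a μ = 0) → μ = 0 := by
    intro μ h
    ext j
    rw [← hl j μ]; exact h _
  obtain ⟨μ', q, heq, hq, hμ'⟩ := exists_decomp φ hsep H (exists_bdd F φ hφ n H hF hH hsep) (2 * k)
    (coef v) (by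
      refine (Finset.card_le_univ _).trans ?_
      simp [two_mul])
  have hvr : ∀ i, φ (Sum.inr i) (coef v) = v i := by
    intro i; rw [hr, ← coef_spec hch]
  obtain ⟨r, hrq, hrc⟩ : ∃ r ∈ AddSubmonoid.closure {r : Fin k → ℕ | (∀ i, r i ≤ H) ∧
        ∀ j, (coef v j < 0 → coef r j ≤ 0) ∧ (0 ≤ coef v j → 0 ≤ coef r j)}, coef r = q := by
    clear heq
    induction hq using AddSubmonoid.closure_induction with
    | mem e he =>
      obtain ⟨hc, hI⟩ := he
      have : ∀ i, ∃ r : ℕ, φ (Sum.inr i) e = r ∧ r ≤ H := by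
        intro i
        obtain ⟨z, hz, hzH⟩ := hI (Sum.inr i)
        have h0 : 0 ≤ φ (Sum.inr i) e := (hc _).1 (by rw [hvr]; positivity)
        rw [hz] at h0
        have h0 : 0 ≤ z := by exact_mod_cast h0
        lift z to ℕ using h0
        exact ⟨z, by simpa using hz, by simpa using hzH⟩
      choose r hr1 hr2 using this
      have hre : coef r = e := by
        rw [hch]
        intro i
        rw [← hr1, hr]
      refine ⟨r, AddSubmonoid.subset_closure ⟨hr2, ?_⟩, hre⟩
      intro j
      rw [hre]
      have := hc (Sum.inl j)
      rw [hl, hl] at this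
      exact ⟨fun h => this.2 h.le, this.1⟩
    | zero => exact ⟨0, zero_mem _, coef_zero hch⟩
    | add x y _ _ hx hy =>
      obtain ⟨r1, h1, h1'⟩ := hx
      obtain ⟨r2, h2, h2'⟩ := hy
      exact ⟨r1 + r2, add_mem h1 h2, by rw [coef_add hch, h1', h2']⟩
  have hdiff : ∀ i, φ (Sum.inr i) μ' = (v i : ℚ) - r i := by
    intro i
    have h1 : μ' = coef v - coef r := by rw [hrc, heq]; abel
    rw [h1, map_sub, hvr, hr, ← coef_spec hch]
  have hrv : r ≤ v := by
    intro i
    have h0 : 0 ≤ φ (Sum.inr i) μ' := by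
      obtain ⟨-, h1, -, h2⟩ := hμ' (Sum.inr i)
      rw [hvr] at h1 h2
      rcases (Nat.cast_nonneg (α := ℚ) (v i)).eq_or_lt with h | h
      · exact (h2 h.symm).ge
      · exact (h1 h).le
    rw [hdiff] at h0
    have : (r i : ℚ) ≤ v i := by linarith
    exact_mod_cast this
  have hcc : coef (v - r) = μ' := by
    rw [coef_sub hch hrv, hrc, heq]; abel
  refine ⟨v - r, ?_, ?_, r, hrq, (tsub_add_cancel_of_le hrv).symm⟩
  · intro i
    have h1 := (hμ' (Sum.inr i)).1
    have h2 : (((v - r) i : ℕ) : ℚ) = φ (Sum.inr i) μ' := by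
      rw [hr, ← hcc, ← coef_spec hch]
    rw [← h2] at h1
    have h3 := (le_abs_self _).trans h1
    exact_mod_cast h3
  · intro j
    obtain ⟨-, h1, h2, h3⟩ := hμ' (Sum.inl j)
    rw [hl, hl] at h1 h2 h3
    rw [hcc]
    refine ⟨h2, fun h => ?_⟩
    rcases h.eq_or_lt with h | h
    · exact (h3 h.symm).ge
    · exact (h1 h).le

lemma main_aux
    (hch : ∀ v e, coef v = e ↔ ∀ i, (v i : ℚ) = ∑ j, (b j i : ℚ) * e j)
    (n H N : ℕ) (hn : 1 ≤ n) (hbn : ∀ j i, b j i ≤ n)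
    (hH : ∀ M : Matrix (Fin k) (Fin k) ℤ, (∀ i j, |M i j| ≤ n) → |M.det| ≤ H)
    (P : Finset (Fin k → ℕ)) (hP : ∀ x ∈ P, ∃ j, b j = x)
    (hN1 : n ≤ N) (hN2 : k * n ≤ N) (hN3 : H ≤ N) (hN4 : 2 * k * H ≤ N) :
    ∃ CS PS : Finset (Fin k) → Finset (Fin k → ℕ),
      (∀ S, (∀ x ∈ CS S, ∀ i, x i ≤ N) ∧ (∀ x ∈ PS S, ∀ i, x i ≤ N)) ∧
      ∀ v, v ∉ LSet1 0 P ↔ ∃ S, v ∈ LSet (CS S) (PS S) := by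
  classical
  let box : Finset (Fin k → ℕ) := Finset.Icc 0 (fun _ => N)
  have hbox : ∀ x, x ∈ box ↔ ∀ i, x i ≤ N := by
    intro x
    simp [box, Finset.mem_Icc, Pi.le_def]
  let PS : Finset (Fin k) → Finset (Fin k → ℕ) := fun S =>
    if S = ∅ then Finset.univ.image b
    else box.filter (fun r => ∀ j, (j ∈ S → coef r j ≤ 0) ∧ (j ∉ S → 0 ≤ coef r j))
  let CS : Finset (Fin k) → Finset (Fin k → ℕ) := fun S =>
    box.filter (fun c => (∀ j, (j ∈ S → coef c j < 0) ∧ (j ∉ S → 0 ≤ coef c j)) ∧ c ∉ LSet1 0 P)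
  have hPS0 : PS ∅ = Finset.univ.image b := if_pos rfl
  have hPS1 : ∀ S, S ≠ ∅ → PS S =
    box.filter (fun r => ∀ j, (j ∈ S → coef r j ≤ 0) ∧ (j ∉ S → 0 ≤ coef r j)) := fun S h => if_neg h
  refine ⟨CS, PS, ?_, ?_⟩
  · intro S
    constructor
    · intro x hx
      exact (hbox x).1 (Finset.mem_filter.1 hx).1
    · intro x hx
      by_cases hS : S = ∅
      · subst hS
        rw [hPS0] at hx
        obtain ⟨j, -, rfl⟩ := Finset.mem_image.1 hx
        exact fun i => (hbn j i).trans hN1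
      · rw [hPS1 S hS] at hx
        exact (hbox x).1 (Finset.mem_filter.1 hx).1
  · intro v
    constructor
    · intro hv
      by_cases h0 : ∀ j, 0 ≤ coef v j
      · obtain ⟨c, hc1, hc2, hc3, q, hq, hvq⟩ := case_empty hch P hP n N hbn hN1 hN2 v hv h0
        refine ⟨∅, (mem_LSet _ _ _).2 ⟨c, ?_, q, ?_, hvq⟩⟩
        · exact Finset.mem_filter.2 ⟨(hbox c).2 hc1, fun j => ⟨by simp, fun _ => hc2 j⟩, hc3⟩
        · rw [hPS0]; simpa using hq
      · obtain ⟨c, hc1, hc2, q, hq, hvq⟩ := case_neg hch n H hn hbn hH v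
        push Not at h0
        obtain ⟨j0, hj0⟩ := h0
        let S : Finset (Fin k) := Finset.univ.filter (fun j => coef v j < 0)
        have hSm : ∀ j, j ∈ S ↔ coef v j < 0 := by intro j; simp [S]
        have hS : S ≠ ∅ := Finset.ne_empty_of_mem ((hSm j0).2 hj0)
        refine ⟨S, (mem_LSet _ _ _).2 ⟨c, ?_, q, ?_, hvq⟩⟩
        · refine Finset.mem_filter.2 ⟨(hbox c).2 fun i => (hc1 i).trans hN4, fun j => ?_, ?_⟩
          · rw [hSm, not_lt]; exact hc2 j
          · rw [mem_L_iff hch P hP]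
            rintro ⟨h, -⟩
            obtain ⟨m, hm⟩ := h j0
            have := (hc2 j0).1 hj0
            rw [hm] at this
            exact absurd this (not_lt.2 (by positivity))
        · refine AddSubmonoid.closure_mono ?_ hq
          rintro r ⟨hr1, hr2⟩
          rw [hPS1 S hS]
          refine Finset.mem_coe.2 (Finset.mem_filter.2 ⟨(hbox r).2 fun i => (hr1 i).trans hN3, fun j => ?_⟩)
          rw [hSm, not_lt]; exact hr2 j
    · rintro ⟨S, hS⟩
      obtain ⟨c, hc, q, hq, rfl⟩ := (mem_LSet _ _ _).1 hS
      obtain ⟨-, hc1, hc2⟩ := Finset.mem_filter.1 hc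
      rw [mem_L_iff hch P hP]
      rintro ⟨h1, h2⟩
      rw [coef_add hch] at h1 h2
      by_cases hS0 : S = ∅
      · subst hS0
        rw [hPS0] at hq
        have hq' : ∀ j, ∃ m : ℕ, coef q j = m := by
          have : q ∈ LSet1 0 (Finset.univ.image b) := (mem_LSet1_zero _ _).2 hq
          exact ((mem_L_iff hch _ (by simp) q).1 this).1
        apply hc2
        rw [mem_L_iff hch P hP]
        have hc0 : ∀ j, 0 ≤ coef c j := fun j => (hc1 j).2 (by simp)
        constructor
        · intro j
          obtain ⟨m, hm⟩ := hq' j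
          obtain ⟨l, hl⟩ := h1 j
          have h0 := hc0 j
          rw [Pi.add_apply, hm] at hl
          have hle : m ≤ l := by
            have : (m : ℚ) ≤ l := by linarith
            exact_mod_cast this
          exact ⟨l - m, by push_cast [hle]; linarith⟩
        · intro j hj
          obtain ⟨m, hm⟩ := hq' j
          have := h2 j hj
          rw [Pi.add_apply, hm] at this
          have h3 : (0:ℚ) ≤ m := by positivity
          linarith [hc0 j]
      · rw [hPS1 S hS0] at hq
        obtain ⟨j, hj⟩ := Finset.nonempty_iff_ne_empty.2 hS0
        have hqj : coef q j ≤ 0 := by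
          clear h1 h2 hS
          induction hq using AddSubmonoid.closure_induction with
          | mem x hx => exact ((Finset.mem_filter.1 (Finset.mem_coe.1 hx)).2 j).1 hj
          | zero => rw [coef_zero hch]; simp
          | add x y hx hy ihx ihy =>
            rw [coef_add hch, Pi.add_apply]
            linarith
        obtain ⟨m, hm⟩ := h1 j
        rw [Pi.add_apply] at hm
        have h3 : (0:ℚ) ≤ m := by positivity
        linarith [(hc1 j).1 hj]

end final

lemma snorm_le {k : ℕ} (A : Finset (Fin k → ℕ)) (N : ℕ) (h : ∀ x ∈ A, ∀ i, x i ≤ N) : snorm A ≤ N :=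
  Finset.sup_le fun x hx => Finset.sup_le fun i _ => h x hx i

/-- Complement of a linear set `L(0,P)` with linearly independent periods. -/
theorem compl_linear_zero (n k : ℕ) (hn : 1 ≤ n) (hk : 1 ≤ k)
    (P : Finset (Fin k → ℕ)) (hind : LinIndep P) (hPn : snorm P ≤ n) :
    ∃ (I : Finset ℕ) (C' P' : ℕ → Finset (Fin k → ℕ)),
      I.card ≤ 2 ^ k + k - 1 ∧
      (∀ i ∈ I,
        (snorm (P' i) : ℝ) ≤ (2 * (k : ℝ) + 1) * (k : ℝ) ^ ((k : ℝ) / 2) * (n : ℝ) ^ k ∧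
        (snorm (C' i) : ℝ) ≤ (2 * (k : ℝ) + 1) * (k : ℝ) ^ ((k : ℝ) / 2) * (n : ℝ) ^ k) ∧
      (LSet1 (0 : Fin k → ℕ) P)ᶜ = ⋃ i ∈ I, LSet (C' i) (P' i) := by
  obtain ⟨b, coef, hbn, hP, hch⟩ := exists_b n k hn P hind hPn
  set A : ℝ := (k : ℝ) ^ ((k : ℝ) / 2) with hA
  have hk1 : (1 : ℝ) ≤ k := by exact_mod_cast hk
  have hn1 : (1 : ℝ) ≤ n := by exact_mod_cast hn
  have hA1 : 1 ≤ A := Real.one_le_rpow hk1 (by positivity)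
  have hnk : (n : ℝ) ≤ (n : ℝ) ^ k := le_self_pow₀ hn1 (by omega)
  set R : ℝ := A * (n : ℝ) ^ k with hR
  have hnR : (n : ℝ) ≤ R := by
    calc (n : ℝ) ≤ (n : ℝ) ^ k := hnk
      _ ≤ A * (n : ℝ) ^ k := le_mul_of_one_le_left (by positivity) hA1
  have hR0 : 0 ≤ R := by linarith
  have hHR : ((⌊R⌋₊ : ℕ) : ℝ) ≤ R := Nat.floor_le hR0
  have hbound : (2 * (k : ℝ) + 1) * A * (n : ℝ) ^ k = (2 * (k : ℝ) + 1) * R := by rw [hR]; ring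
  obtain ⟨CS, PS, hnorm, hmem⟩ := main_aux hch n ⌊R⌋₊ ⌊(2 * (k : ℝ) + 1) * R⌋₊ hn hbn
    (by
      intro M hM
      have h1 := hadamard_bound k n M hM
      have h2 : M.det.natAbs ≤ ⌊R⌋₊ := by
        apply Nat.le_floor
        rw [Nat.cast_natAbs]
        exact h1
      rw [Int.abs_eq_natAbs]
      exact_mod_cast h2)
    P hP
    (Nat.le_floor (by nlinarith))
    (Nat.le_floor (by push_cast; nlinarith))
    (Nat.le_floor (by nlinarith))
    (Nat.le_floor (by push_cast; nlinarith))
  have hfl : ((⌊(2 * (k : ℝ) + 1) * R⌋₊ : ℕ) : ℝ) ≤ (2 * (k : ℝ) + 1) * R :=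
    Nat.floor_le (by positivity)
  let f : Finset (Fin k) → ℕ := fun S => (Fintype.equivFin (Finset (Fin k)) S : ℕ)
  have hf : Function.Injective f := fun S T h =>
    (Fintype.equivFin (Finset (Fin k))).injective (Fin.ext h)
  have hg : ∀ S, Function.invFun f (f S) = S := Function.leftInverse_invFun hf
  refine ⟨Finset.univ.image f, fun i => CS (Function.invFun f i), fun i => PS (Function.invFun f i),
    ?_, ?_, ?_⟩
  · have h1 : (Finset.univ.image f).card ≤ 2 ^ k := by
      refine Finset.card_image_le.trans ?_
      simp
    omega
  · intro i _
    rw [hbound]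
    refine ⟨le_trans ?_ hfl, le_trans ?_ hfl⟩
    · exact_mod_cast snorm_le _ _ (hnorm _).2
    · exact_mod_cast snorm_le _ _ (hnorm _).1
  · ext v
    rw [Set.mem_compl_iff, hmem]
    simp only [Set.mem_iUnion, Finset.mem_image, Finset.mem_univ, true_and, exists_prop]
    constructor
    · rintro ⟨S, hS⟩
      exact ⟨f S, ⟨S, rfl⟩, by rwa [hg]⟩
    · rintro ⟨i, -, hi⟩
      exact ⟨_, hi⟩
end

section
/- Let k ≥ 1 and let ⋃_{i ∈ I} L(x_i, P_i) be a semilinear subset of ℕ^k with I nonempty finite and each P_i linearly independent (over ℚ). Set n = max_{i ∈ I} ‖P_i‖, ℓ = max_{i ∈ I} ‖x_i‖, and q = ⌈log₂ |I|⌉. Then there exists an index set J with |J| ≤ (4k(n+1))^{5(k+2)(3k+2)^{q+1}} (ℓ+1)^{k·2^{q+1}} such that for each j ∈ J there are finite sets P_j, C_j ⊆ ℕ^k with ‖P_j‖ ≤ (4k(n+1))^{(k+2)(3k+1)^q} and ‖C_j‖ ≤ (4k(n+1))^{(k+2)(3k+2)^q + k}·(ℓ+1), and ℕ^k \ ⋃_{i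 ∈ I} L(x_i, P_i) = ⋃_{j ∈ J} L(C_j, P_j). -/
/-- directions keeping all tight constraints tight -/
def tightK {V ι : Type*} [AddCommGroup V] [Module ℚ V] (a : ι → V →ₗ[ℚ] ℚ) (v : V) : Submodule ℚ V where
  carrier := {y | ∀ i, a i v = 0 → a i y = 0}
  add_mem' := by
    intro x y hx hy i hi
    simp [hx i hi, hy i hi]
  zero_mem' := by intro i _; simp
  smul_mem' := by
    intro c x hx i hi
    simp [hx i hi]

lemma cone_hit {V ι : Type*} [Fintype ι] [AddCommGroup V] [Module ℚ V] (a : ι → V →ₗ[ℚ] ℚ)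
    (v y : V) (hv : ∀ i, 0 ≤ a i v) (hy : y ∈ tightK a v) (hneg : ∃ i, a i y < 0) :
    ∃ t : ℚ, 0 < t ∧ (∀ i, 0 ≤ a i (v + t • y)) ∧ tightK a (v + t • y) < tightK a v := by
  classical
  have hne : (Finset.univ.filter (fun i => a i y < 0)).Nonempty := by
    obtain ⟨i, hi⟩ := hneg
    exact ⟨i, by simp [hi]⟩
  obtain ⟨i0, hi0, hmin⟩ := Finset.exists_min_image _ (fun i => a i v / (-(a i y))) hne
  have hi0' : a i0 y < 0 := by simpa using hi0
  have hvi0 : 0 < a i0 v := by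
    rcases (hv i0).lt_or_eq with h | h
    · exact h
    · exact absurd (hy i0 h.symm) hi0'.ne
  refine ⟨a i0 v / (-(a i0 y)), div_pos hvi0 (by linarith), ?_, ?_⟩
  · intro i
    have ht : 0 < a i0 v / (-(a i0 y)) := div_pos hvi0 (by linarith)
    simp only [map_add, map_smul, smul_eq_mul]
    by_cases hi : a i y < 0
    · have := hmin i (by simp [hi])
      rw [le_div_iff₀ (by linarith)] at this
      linarith
    · have := mul_nonneg ht.le (not_lt.mp hi)
      linarith [hv i]
  · refine lt_of_le_of_ne ?_ ?_
    · intro z hz i hi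
      apply hz
      simp [hi, hy i hi]
    · intro h
      rw [← h] at hy
      have := hy i0 (by
        simp only [map_add, map_smul, smul_eq_mul]
        have h0 := hi0'.ne
        field_simp
        ring)
      linarith

lemma cone_decomp {V ι : Type*} [Fintype ι] [AddCommGroup V] [Module ℚ V] [FiniteDimensional ℚ V]
    (a : ι → V →ₗ[ℚ] ℚ) (hp : ∀ y, (∀ i, a i y = 0) → y = 0) :
    ∀ (m : ℕ) (v : V), (∀ i, 0 ≤ a i v) → Module.finrank ℚ (tightK a v) ≤ m →
      ∃ f : Fin m → V, v = ∑ s, f s ∧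
        ∀ s, (∀ i, 0 ≤ a i (f s)) ∧ ∀ y ∈ tightK a (f s), f s = 0 ∨ ∃ c : ℚ, y = c • f s := by
  intro m
  induction m with
  | zero =>
    intro v hv hd
    have hb : tightK a v = ⊥ := Submodule.finrank_eq_zero.mp (by omega)
    have hv0 : v ∈ tightK a v := fun i hi => hi
    rw [hb] at hv0
    refine ⟨fun _ => 0, by simpa using hv0, fun s => s.elim0⟩
  | succ m ih =>
    intro v hv hd
    by_cases hv0 : v = 0
    · exact ⟨fun _ => 0, by simp [hv0], fun s => ⟨by simp, by simp⟩⟩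
    by_cases hext : ∀ y ∈ tightK a v, ∃ c : ℚ, y = c • v
    · refine ⟨Fin.cons v (fun _ => 0), by simp [Fin.sum_univ_succ], fun s => ?_⟩
      refine Fin.cases ?_ (fun s => ?_) s
      · exact ⟨by simpa using hv, fun y hy => Or.inr (by simpa using hext y (by simpa using hy))⟩
      · simp
    push Not at hext
    obtain ⟨y, hy, hyv⟩ := hext
    have hv' : ∃ v', v' ≠ 0 ∧ (∀ i, 0 ≤ a i v') ∧ tightK a v' < tightK a v := by
      have hy0 : y ≠ 0 := fun h => hyv 0 (by simp [h])
      have key : ∀ z, z ∈ tightK a v → (∀ c : ℚ, z ≠ c • v) → (∃ i, a i z < 0) →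
          ∃ v', v' ≠ 0 ∧ (∀ i, 0 ≤ a i v') ∧ tightK a v' < tightK a v := by
        intro z hz hzv hzn
        obtain ⟨t, ht, h1, h2⟩ := cone_hit a v z hv hz hzn
        refine ⟨_, ?_, h1, h2⟩
        intro h0
        apply hzv (-t⁻¹)
        have : v = -(t • z) := eq_neg_of_add_eq_zero_left h0
        rw [this, smul_neg, neg_smul, neg_neg, smul_smul, inv_mul_cancel₀ ht.ne', one_smul]
      by_cases hn : ∃ i, a i y < 0
      · exact key y hy hyv hn
      · push Not at hn
        refine key (-y) (Submodule.neg_mem _ hy) ?_ ?_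
        · intro c hc
          exact hyv (-c) (by rw [neg_smul, ← hc, neg_neg])
        · by_contra hcon
          push Not at hcon
          apply hy0
          apply hp
          intro i
          have := hcon i
          rw [map_neg] at this
          linarith [hn i]
    obtain ⟨v', hv'0, hv'c, hv'lt⟩ := hv'
    have hlt := Submodule.finrank_lt_finrank_of_lt hv'lt
    obtain ⟨f, hf, hfs⟩ := ih v' hv'c (by omega)
    have : ∃ s, f s ≠ 0 := by
      by_contra hcon
      push Not at hcon
      apply hv'0
      rw [hf]; simp [hcon]
    obtain ⟨s0, hs0⟩ := this
    have htight : ∀ i, a i v = 0 → a i (f s0) = 0 := by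
      intro i hi
      have h1 : a i v' = 0 := by
        have : v' ∈ tightK a v := hv'lt.le (fun i hi => hi)
        exact this i hi
      rw [hf, map_sum] at h1
      exact (Finset.sum_eq_zero_iff_of_nonneg (fun s _ => (hfs s).1 i)).mp h1 s0 (Finset.mem_univ _)
    have hneg : ∃ i, a i (-(f s0)) < 0 := by
      by_contra hcon
      push Not at hcon
      apply hs0
      apply hp
      intro i
      have := hcon i
      rw [map_neg] at this
      linarith [(hfs s0).1 i]
    obtain ⟨t, ht, h1, h2⟩ := cone_hit a v (-(f s0)) hv (Submodule.neg_mem _ htight) hneg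
    have hlt2 := Submodule.finrank_lt_finrank_of_lt h2
    obtain ⟨g, hg, hgs⟩ := ih _ h1 (by omega)
    refine ⟨Fin.cons (t • f s0) g, ?_, fun s => ?_⟩
    · simp only [Fin.sum_univ_succ, Fin.cons_zero, Fin.cons_succ, ← hg]
      simp
    · refine Fin.cases ?_ (fun s => ?_) s
      · simp only [Fin.cons_zero]
        refine ⟨fun i => ?_, fun z hz => Or.inr ?_⟩
        · rw [map_smul]; exact mul_nonneg ht.le ((hfs s0).1 i)
        · have hz' : z ∈ tightK a (f s0) := by
            intro i hi
            apply hz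
            simp [hi]
          rcases (hfs s0).2 z hz' with h | ⟨c, hc⟩
          · exact absurd h hs0
          · exact ⟨c * t⁻¹, by rw [smul_smul, mul_assoc, inv_mul_cancel₀ ht.ne', mul_one, hc]⟩
      · simpa using hgs s

lemma exists_rows {ι : Type*} {k : ℕ} (v : ι → Fin k → ℤ) (s t : Set ι)
    (hs : LinearIndepOn ℚ (fun i j => (v i j : ℚ)) s) (hst : s ⊆ t)
    (hker : ∀ y : Fin k → ℚ, (∀ i ∈ t, ∑ j, (v i j : ℚ) * y j = 0) → y = 0) :
    ∃ f : Fin k → ι, Function.Injective f ∧ (∀ j, f j ∈ t) ∧ s ⊆ Set.range f ∧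
      (Matrix.of fun i j => v (f i) j).det ≠ 0 := by
  obtain ⟨b, hbt, hsb, htb, hb⟩ := exists_linearIndepOn_extension hs hst
  set w : ι → Fin k → ℚ := fun i j => (v i j : ℚ) with hw
  have htop : Submodule.span ℚ (Set.image w b) = ⊤ := by
    by_contra hne
    obtain ⟨g, hg0, hg⟩ := Submodule.exists_le_ker_of_lt_top _ (lt_top_iff_ne_top.mpr hne)
    have hgy : ∀ x : Fin k → ℚ, g x = ∑ j, x j * g (Pi.single j 1) := by
      intro x
      conv_lhs => rw [pi_eq_sum_univ' x]
      simp [map_sum]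
    have := hker (fun j => g (Pi.single j 1)) (by
      intro i hi
      have h1 : w i ∈ Submodule.span ℚ (Set.image w b) := htb ⟨i, hi, rfl⟩
      have h2 : g (w i) = 0 := hg h1
      rw [hgy] at h2
      exact h2)
    apply hg0
    ext x
    simpa using congrFun this x
  have hbas : Module.Basis b ℚ (Fin k → ℚ) := Module.Basis.mk hb (by
    rw [← htop, Set.image_eq_range])
  have : Fintype b := FiniteDimensional.fintypeBasisIndex hbas
  have hcard : Fintype.card b = k := by
    have := Module.finrank_eq_card_basis hbas
    simpa using this.symm
  let e : Fin k ≃ b := (Fintype.equivFinOfCardEq hcard).symm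
  refine ⟨fun i => (e i : ι), fun i j h => e.injective (Subtype.ext h), fun j => hbt (e j).2, ?_, ?_⟩
  · intro i hi
    exact ⟨e.symm ⟨i, hsb hi⟩, by simp⟩
  · intro h0
    have hli : LinearIndependent ℚ (fun i : Fin k => w (e i)) :=
      LinearIndependent.comp hb e e.injective
    have hu : IsUnit (Matrix.of fun i j => ((v (e i) j : ℤ) : ℚ)) :=
      Matrix.linearIndependent_rows_iff_isUnit.mp hli
    rw [Matrix.isUnit_iff_isUnit_det] at hu
    apply hu.ne_zero
    have h3 : (Matrix.of fun i j => ((v (e i) j : ℤ) : ℚ)) =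
      (Int.castRingHom ℚ).mapMatrix (Matrix.of fun i j => v (e i) j) := by
      ext; simp
    rw [h3, ← RingHom.map_det, h0, map_zero]

lemma det_bd {k : ℕ} (A : Matrix (Fin k) (Fin k) ℤ) (N : ℕ) (hA : ∀ i j, |A i j| ≤ N) :
    |A.det| ≤ (k.factorial * N ^ k : ℕ) := by
  have := Matrix.det_le (A := A) (abv := AbsoluteValue.abs) (x := (N : ℤ)) hA
  simpa using this

lemma adj_bd {k : ℕ} (A : Matrix (Fin k) (Fin k) ℤ) (N : ℕ) (hN : 1 ≤ N) (hA : ∀ i j, |A i j| ≤ N)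
    (i j : Fin k) : |A.adjugate i j| ≤ (k.factorial * N ^ k : ℕ) := by
  rw [Matrix.adjugate_apply]
  apply det_bd
  intro a b
  have hN' : (1 : ℤ) ≤ N := by exact_mod_cast hN
  rw [Matrix.updateRow_apply]
  split_ifs
  · rw [Pi.single_apply]
    split_ifs <;> (simp; try linarith)
  · exact hA a b

lemma cramer_eq {k : ℕ} (A : Matrix (Fin k) (Fin k) ℤ) (u b : Fin k → ℚ)
    (h : ∀ i, ∑ j, (A i j : ℚ) * u j = b i) (j : Fin k) :
    (A.det : ℚ) * u j = ∑ i, (A.adjugate j i : ℚ) * b i := by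
  have h1 : ((Int.castRingHom ℚ).mapMatrix A).mulVec u = b := by
    ext i; simp [Matrix.mulVec, dotProduct, ← h i]
  have h2 : ((Int.castRingHom ℚ).mapMatrix A).adjugate.mulVec b =
      ((Int.castRingHom ℚ).mapMatrix A).det • u := by
    rw [← h1, Matrix.mulVec_mulVec, Matrix.adjugate_mul, Matrix.smul_mulVec, Matrix.one_mulVec]
  have h3 := congrFun h2 j
  rw [← RingHom.map_adjugate, ← RingHom.map_det] at h3
  simp [Matrix.mulVec, dotProduct] at h3
  exact h3.symm

lemma vertex_bd {ι : Type*} {k : ℕ} (a : ι → Fin k → ℤ) (N : ℕ) (hN : 1 ≤ N)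
    (ha : ∀ i j, |a i j| ≤ N) (b : ι → ℚ) (β : ℚ) (hb : ∀ i, |b i| ≤ β) (T : Set ι)
    (y : Fin k → ℚ) (hy : ∀ i ∈ T, ∑ j, (a i j : ℚ) * y j = b i)
    (hker : ∀ y : Fin k → ℚ, (∀ i ∈ T, ∑ j, (a i j : ℚ) * y j = 0) → y = 0) (j : Fin k) :
    |y j| ≤ k * (k.factorial * N ^ k : ℕ) * β := by
  obtain ⟨f, -, hfT, -, hdet⟩ := exists_rows a ∅ T (linearIndepOn_empty _ _)
    (Set.empty_subset _) hker
  set A : Matrix (Fin k) (Fin k) ℤ := Matrix.of fun i j => a (f i) j with hA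
  have h := cramer_eq A y (fun i => b (f i)) (fun i => hy _ (hfT i)) j
  have hd : (1 : ℚ) ≤ |(A.det : ℚ)| := by
    have := Int.one_le_abs hdet
    exact_mod_cast this
  have h1 : |y j| ≤ |(A.det : ℚ) * y j| := by
    rw [abs_mul]
    nlinarith [abs_nonneg (y j)]
  refine h1.trans ?_
  rw [h]
  refine (Finset.abs_sum_le_sum_abs _ _).trans ?_
  have : ∀ i ∈ (Finset.univ : Finset (Fin k)), |(A.adjugate j i : ℚ) * b (f i)| ≤
      (k.factorial * N ^ k : ℕ) * β := by
    intro i _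
    rw [abs_mul]
    have h2 := adj_bd A N hN (fun i j => ha _ _) j i
    have h3 : |(A.adjugate j i : ℚ)| ≤ (k.factorial * N ^ k : ℕ) := by exact_mod_cast h2
    exact mul_le_mul h3 (hb _) (abs_nonneg _) (by positivity)
  refine (Finset.sum_le_card_nsmul _ _ _ this).trans ?_
  simp [mul_assoc]

lemma ray_int {ι : Type*} {k : ℕ} (a : ι → Fin k → ℤ) (N : ℕ) (hN : 1 ≤ N)
    (ha : ∀ i j, |a i j| ≤ N) (T : Set ι)
    (r : Fin k → ℚ) (hr0 : r ≠ 0) (hr : ∀ i ∈ T, ∑ j, (a i j : ℚ) * r j = 0)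
    (hker : ∀ y : Fin k → ℚ, (∀ i ∈ T, ∑ j, (a i j : ℚ) * y j = 0) → ∃ c : ℚ, y = c • r) :
    ∃ (p : Fin k → ℤ) (μ : ℚ), 0 < μ ∧ (∀ j, |p j| ≤ (k.factorial * N ^ k : ℕ)) ∧
      ∀ j, r j = μ * p j := by
  classical
  obtain ⟨j0, hj0⟩ := Function.ne_iff.mp hr0
  simp only [Pi.zero_apply] at hj0
  let a' : Option ι → Fin k → ℤ := fun o => o.elim (Pi.single j0 1) a
  have hN' : (1 : ℤ) ≤ N := by exact_mod_cast hN
  have ha' : ∀ o j, |a' o j| ≤ N := by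
    intro o j
    cases o with
    | none =>
      simp only [a', Option.elim]
      rw [Pi.single_apply]
      split_ifs <;> (simp; try linarith)
    | some i => exact ha i j
  have hnone : ∀ y : Fin k → ℚ, ∑ j, (a' none j : ℚ) * y j = y j0 := by
    intro y
    simp [a', Pi.single_apply]
  obtain ⟨f, hf, hfT, -, hdet⟩ := exists_rows a' ∅ (insert none (Set.image some T)) (linearIndepOn_empty _ _)
    (Set.empty_subset _) (by
      intro y hy
      obtain ⟨c, hc⟩ := hker y (fun i hi => hy (some i) (by simp [hi]))
      have := hy none (by simp)
      rw [hnone, hc] at this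
      simp [hj0] at this
      rw [hc, this, zero_smul])
  set A : Matrix (Fin k) (Fin k) ℤ := Matrix.of fun i j => a' (f i) j with hA
  have hd : (A.det : ℚ) ≠ 0 := by exact_mod_cast hdet
  have h := cramer_eq A r (fun i => if f i = none then r j0 else 0) (by
    intro i
    rcases hfT i with h | ⟨i', hi', h⟩
    · simp only [A, Matrix.of_apply, h, hnone, if_true]
    · simp only [A, Matrix.of_apply, ← h]
      simpa [a'] using hr i' hi')
  have hex : ∃ i0, f i0 = none := by
    by_contra hcon
    push Not at hcon
    have := h j0
    simp [hcon, hj0] at this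
    exact hdet this
  obtain ⟨i0, hi0⟩ := hex
  have hiff : ∀ i, f i = none ↔ i = i0 := fun i =>
    ⟨fun h => hf (h.trans hi0.symm), fun h => h ▸ hi0⟩
  simp only [hiff, mul_ite, mul_zero, Finset.sum_ite_eq', Finset.mem_univ, if_true] at h
  have hadj : ∀ j, |A.adjugate j i0| ≤ (k.factorial * N ^ k : ℕ) := fun j =>
    adj_bd A N hN (fun i j => ha' _ _) j i0
  have hrj : ∀ j, r j = (r j0 / A.det) * A.adjugate j i0 := by
    intro j
    field_simp
    linarith [h j]
  have hne : r j0 / A.det ≠ 0 := div_ne_zero hj0 hd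
  rcases lt_or_gt_of_ne hne with hlt | hgt
  · refine ⟨fun j => - A.adjugate j i0, -(r j0 / A.det), by linarith, ?_, ?_⟩
    · intro j; rw [abs_neg]; exact hadj j
    · intro j
      conv_lhs => rw [hrj j]
      push_cast; ring
  · exact ⟨fun j => A.adjugate j i0, r j0 / A.det, hgt, hadj, hrj⟩

lemma poly_decomp {ι : Type*} [Fintype ι] {k : ℕ} (a : ι → Fin k → ℤ) (N : ℕ) (hN : 1 ≤ N)
    (ha : ∀ i j, |a i j| ≤ N) (b : ι → ℚ) (β : ℚ) (hb : ∀ i, |b i| ≤ β)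
    (hker : ∀ y : Fin k → ℚ, (∀ i, ∑ j, (a i j : ℚ) * y j = 0) → y = 0)
    (u : Fin k → ℚ) (hu : ∀ i, b i ≤ ∑ j, (a i j : ℚ) * u j) :
    ∃ (w : Fin k → ℚ) (r : Fin (k + 1) → Fin k → ℤ) (μ : Fin (k + 1) → ℚ),
      (∀ j, u j = w j + ∑ s, μ s * r s j) ∧ (∀ s, 0 ≤ μ s) ∧
      (∀ s i, 0 ≤ ∑ j, a i j * r s j) ∧ (∀ i, b i ≤ ∑ j, (a i j : ℚ) * w j) ∧
      (∀ j, |w j| ≤ k * (k.factorial * N ^ k : ℕ) * β) ∧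
      (∀ s j, |r s j| ≤ (k.factorial * N ^ k : ℕ)) := by
  classical
  let dot : ι → (Fin k → ℚ) →ₗ[ℚ] ℚ := fun i => ∑ j, (a i j : ℚ) • LinearMap.proj j
  have hdot : ∀ i y, dot i y = ∑ j, (a i j : ℚ) * y j := by
    intro i y; simp [dot]
  let g : Option ι → ((Fin k → ℚ) × ℚ) →ₗ[ℚ] ℚ := fun o =>
    o.elim (LinearMap.snd ℚ _ _)
      (fun i => dot i ∘ₗ LinearMap.fst ℚ _ _ - b i • LinearMap.snd ℚ _ _)
  have gn : ∀ z, g none z = z.2 := fun z => rfl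
  have gs : ∀ i z, g (some i) z = (∑ j, (a i j : ℚ) * z.1 j) - b i * z.2 := by
    intro i z; simp [g, hdot]
  have hp : ∀ y, (∀ i, g i y = 0) → y = 0 := by
    intro y hy
    have h2 : y.2 = 0 := hy none
    refine Prod.ext (hker _ fun i => ?_) h2
    have := hy (some i)
    rw [gs, h2] at this
    simpa using this
  obtain ⟨f, hf, hfs⟩ := cone_decomp g hp (k + 1) (u, 1) (by
    intro o
    cases o with
    | none => simp [gn]
    | some i => rw [gs]; simpa using hu i) ((Submodule.finrank_le _).trans (by simp))
  have ht0 : ∀ s, 0 ≤ (f s).2 := fun s => (hfs s).1 none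
  have hfi : ∀ s i, b i * (f s).2 ≤ ∑ j, (a i j : ℚ) * (f s).1 j := by
    intro s i
    have := (hfs s).1 (some i)
    rw [gs] at this; linarith
  -- points with positive height
  have hpos : ∀ s, 0 < (f s).2 → ∀ j, |(f s).1 j| ≤ (f s).2 * (k * (k.factorial * N ^ k : ℕ) * β) := by
    intro s hs j
    have h1 := vertex_bd a N hN ha b β hb {i | g (some i) (f s) = 0}
      (fun j => (f s).1 j / (f s).2) (by
        intro i hi
        have hi' : g (some i) (f s) = 0 := hi
        rw [gs] at hi'
        simp only [← mul_div_assoc]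
        rw [← Finset.sum_div, div_eq_iff hs.ne']
        linarith) (by
        intro y hy
        have hm : ((y, 0) : (Fin k → ℚ) × ℚ) ∈ tightK g (f s) := by
          intro o ho
          cases o with
          | none => rfl
          | some i => rw [gs]; simpa using hy i ho
        rcases (hfs s).2 _ hm with h | ⟨c, hc⟩
        · rw [h] at hs; simp at hs
        · have h2 := congrArg Prod.snd hc
          simp [hs.ne'] at h2
          have h3 := congrArg Prod.fst hc
          simpa [h2] using h3) j
    rw [abs_div, abs_of_pos hs, div_le_iff₀ hs] at h1
    linarith
  -- rays
  have hray : ∀ s, (f s).2 = 0 → ∃ (p : Fin k → ℤ) (μ : ℚ), 0 ≤ μ ∧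
      (∀ j, |p j| ≤ (k.factorial * N ^ k : ℕ)) ∧ (∀ j, (f s).1 j = μ * p j) ∧
      ∀ i, 0 ≤ ∑ j, a i j * p j := by
    intro s hs
    by_cases hz : (f s).1 = 0
    · refine ⟨0, 0, le_rfl, fun j => by simp; positivity, fun j => by simp [hz], fun i => by simp⟩
    obtain ⟨p, μ, hμ, hpb, hpe⟩ := ray_int a N hN ha {i | g (some i) (f s) = 0} (f s).1 hz (by
        intro i hi
        have hi' : g (some i) (f s) = 0 := hi
        rw [gs, hs] at hi'
        simpa using hi') (by
        intro y hy
        have hm : ((y, 0) : (Fin k → ℚ) × ℚ) ∈ tightK g (f s) := by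
          intro o ho
          cases o with
          | none => rfl
          | some i => rw [gs]; simpa using hy i ho
        rcases (hfs s).2 _ hm with h | ⟨c, hc⟩
        · rw [h] at hz; simp at hz
        · exact ⟨c, congrArg Prod.fst hc⟩)
    refine ⟨p, μ, hμ.le, hpb, hpe, fun i => ?_⟩
    have h1 := hfi s i
    rw [hs, mul_zero] at h1
    simp only [hpe] at h1
    have h2 : ∑ j, (a i j : ℚ) * (μ * p j) = μ * ∑ j, (a i j : ℚ) * p j := by
      rw [Finset.mul_sum]; exact Finset.sum_congr rfl fun j _ => by ring
    rw [h2] at h1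
    have h3 : (0 : ℚ) ≤ ∑ j, (a i j : ℚ) * p j := nonneg_of_mul_nonneg_right h1 hμ
    exact_mod_cast h3
  have hall : ∀ s, ∃ (p : Fin k → ℤ) (μ : ℚ), 0 ≤ μ ∧
      (∀ j, |p j| ≤ (k.factorial * N ^ k : ℕ)) ∧
      (∀ j, (if (f s).2 = 0 then (f s).1 j else 0) = μ * p j) ∧
      ∀ i, 0 ≤ ∑ j, a i j * p j := by
    intro s
    by_cases hs : (f s).2 = 0
    · simpa [hs] using hray s hs
    · exact ⟨0, 0, le_rfl, fun j => by simp; positivity, fun j => by simp [hs], fun i => by simp⟩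
  choose p μ hμ hpb hpe hpi using hall
  have hsum2 : ∑ s, (f s).2 = 1 := by
    have := congrArg Prod.snd hf
    simpa [Prod.snd_sum] using this.symm
  refine ⟨fun j => ∑ s, if (f s).2 = 0 then 0 else (f s).1 j, p, μ, ?_, hμ, fun s i => hpi s i, ?_, ?_,
    hpb⟩
  · intro j
    have h1 := congrFun (congrArg Prod.fst hf) j
    simp only [Prod.fst_sum, Finset.sum_apply] at h1
    rw [h1, ← Finset.sum_add_distrib]
    refine Finset.sum_congr rfl fun s _ => ?_
    rw [← hpe]
    split_ifs <;> simp
  · intro i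
    simp only [Finset.mul_sum]
    rw [Finset.sum_comm]
    calc b i = ∑ s, b i * (f s).2 := by rw [← Finset.mul_sum, hsum2, mul_one]
      _ ≤ _ := by
        refine Finset.sum_le_sum fun s _ => ?_
        split_ifs with h
        · simp [h]
        · exact hfi s i
  · intro j
    refine (Finset.abs_sum_le_sum_abs _ _).trans ?_
    calc _ ≤ ∑ s, (f s).2 * (k * (k.factorial * N ^ k : ℕ) * β) := by
          refine Finset.sum_le_sum fun s _ => ?_
          split_ifs with h
          · simp [h]
          · exact hpos s (lt_of_le_of_ne (ht0 s) (Ne.symm h)) j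
      _ = _ := by rw [← Finset.sum_mul, hsum2, one_mul]

lemma mem_LSet_of_sum {k : ℕ} {σ : Type*} [Fintype σ] (C P : Finset (Fin k → ℕ)) (c : Fin k → ℕ)
    (hc : c ∈ C) (p : σ → Fin k → ℕ) (hp : ∀ s, p s ∈ P) (m : σ → ℕ) :
    c + ∑ s, m s • p s ∈ LSet C P := by
  classical
  refine ⟨c, hc, fun x => ∑ s ∈ Finset.univ.filter (fun s => p s = x), m s, ?_⟩
  congr 1
  rw [← Finset.sum_fiberwise_of_maps_to (t := P) (g := p) (fun s _ => hp s)]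
  refine Finset.sum_congr rfl fun x _ => ?_
  rw [Finset.sum_smul]
  refine Finset.sum_congr rfl fun s hs => ?_
  rw [(Finset.mem_filter.mp hs).2]

lemma sign_add_compat (x z : ℚ) (h1 : SignType.sign x ≠ -1 → 0 ≤ z)
    (h2 : SignType.sign x ≠ 1 → z ≤ 0) : SignType.sign (x + z) = SignType.sign x := by
  rcases lt_trichotomy x 0 with h | h | h
  · have := h2 (by rw [sign_neg h]; decide)
    rw [sign_neg h, sign_neg (by linarith)]
  · subst h
    have a1 := h1 (by simp)
    have a2 := h2 (by simp)
    have : z = 0 := le_antisymm a2 a1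
    simp [this]
  · have := h1 (by rw [sign_pos h]; decide)
    rw [sign_pos h, sign_pos (by linarith)]

lemma vnorm_le {k : ℕ} (x : Fin k → ℕ) (b : ℕ) : vnorm x ≤ b ↔ ∀ j, x j ≤ b := by
  simp [vnorm]

lemma snorm_le_s8 {k : ℕ} (P : Finset (Fin k → ℕ)) (b : ℕ) :
    snorm P ≤ b ↔ ∀ x ∈ P, ∀ j, x j ≤ b := by
  simp [snorm, vnorm_le]

/-- two sign conditions force the same sign -/
lemma sign_eq_of (f g : ℚ) (h1 : min |f| 1 ≤ (if f < 0 then -1 else 1) * g)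
    (h2 : min |f| 1 ≤ (if 0 < f then 1 else -1) * g) : SignType.sign g = SignType.sign f := by
  rcases lt_trichotomy f 0 with h | h | h
  · have : 0 < min |f| 1 := lt_min (abs_pos.mpr h.ne) one_pos
    simp only [h, if_true] at h1
    rw [sign_neg h, sign_neg (by linarith)]
  · subst h
    simp at h1 h2
    have : g = 0 := by linarith
    simp [this]
  · have : 0 < min |f| 1 := lt_min (abs_pos.mpr h.ne') one_pos
    simp only [h, if_true] at h2
    rw [sign_pos h, sign_pos (by linarith)]

theorem general_rep {ι : Type*} [Fintype ι] {k : ℕ} (S : Set (Fin k → ℕ))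
    (B : Matrix (Fin k) (Fin k) ℤ) (hB : B.det ≠ 0) (x0 : Fin k → ℕ) (D : ℕ) (hD : 0 < D)
    (a : ι → Fin k → ℤ) (t : ι → ℤ) (N nB β ℓ : ℕ) (hN : 1 ≤ N)
    (hBn : ∀ i j, |B i j| ≤ nB) (hnN : nB ≤ N) (ha : ∀ i j, |a i j| ≤ N)
    (ht : ∀ i, |t i| + 1 ≤ β) (hx : ∀ j, x0 j ≤ ℓ) (hℓβ : ℓ ≤ β)
    (U : (Fin k → ℕ) → Fin k → ℚ)
    (hU : ∀ v j, ∑ l, (B j l : ℚ) * U v l = (v j : ℚ) - x0 j)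
    (hS : ∀ (v v' : Fin k → ℕ) (η : Fin k → ℤ),
      (∀ j, (v' j : ℤ) = v j + D * ∑ l, B j l * η l) →
      (∀ i, SignType.sign (∑ j, (a i j : ℚ) * U v' j - t i) =
        SignType.sign (∑ j, (a i j : ℚ) * U v j - t i)) → v ∈ S → v' ∈ S) :
    ∃ (J : Finset ℕ) (C' P' : ℕ → Finset (Fin k → ℕ)),
      J.card ≤ 3 ^ (Fintype.card ι) ∧
      (∀ j ∈ J, snorm (P' j) ≤ D * (k * nB * (k.factorial * N ^ k)) ∧
        snorm (C' j) ≤ ℓ + k * nB * (k * (k.factorial * N ^ k) * β +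
          (k + 1) * (D * (k.factorial * N ^ k)))) ∧
      S = ⋃ j ∈ J, LSet (C' j) (P' j) := by
  classical
  set R : ℕ := k.factorial * N ^ k with hR
  set bP := D * (k * nB * R) with hbP
  set bC := ℓ + k * nB * (k * R * β + (k + 1) * (D * R)) with hbC
  have hinj : ∀ y : Fin k → ℚ, (∀ j, ∑ l, (B j l : ℚ) * y l = 0) → y = 0 := by
    intro y hy
    ext j
    have := cramer_eq B y 0 (by simpa using hy) j
    have hd : (B.det : ℚ) ≠ 0 := by exact_mod_cast hB
    simpa [hd] using this
  have huniq : ∀ v (y : Fin k → ℚ), (∀ j, ∑ l, (B j l : ℚ) * y l = (v j : ℚ) - x0 j) → U v = y := by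
    intro v y hy
    have := hinj (U v - y) (by
      intro j
      simp only [Pi.sub_apply, mul_sub, Finset.sum_sub_distrib, hU, hy, sub_self])
    exact sub_eq_zero.mp this
  have hshift : ∀ (v v' : Fin k → ℕ) (η : Fin k → ℤ),
      (∀ j, (v' j : ℤ) = v j + D * ∑ l, B j l * η l) → ∀ l, U v' l = U v l + D * η l := by
    intro v v' η h l
    refine congrFun (huniq v' (fun l => U v l + D * η l) ?_) l
    intro j
    have h1 : (v' j : ℚ) = v j + D * ∑ l, (B j l : ℚ) * η l := by exact_mod_cast h j
    rw [h1]
    simp only [mul_add, Finset.sum_add_distrib, hU, Finset.mul_sum]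
    have : ∑ x, (B j x : ℚ) * (D * η x) = ∑ x, (D : ℚ) * (B j x * η x) :=
      Finset.sum_congr rfl fun _ _ => by ring
    rw [this]; ring
  let F : (Fin k → ℕ) → ι → ℚ := fun v i => ∑ j, (a i j : ℚ) * U v j - t i
  let Pσ : (ι → SignType) → Finset (Fin k → ℕ) := fun σ =>
    (Fintype.piFinset (fun _ => Finset.range (bP + 1))).filter
      (fun p => ∃ r : Fin k → ℤ, (∀ j, (p j : ℤ) = D * ∑ l, B j l * r l) ∧
        ∀ i, (σ i ≠ -1 → 0 ≤ ∑ j, a i j * r j) ∧ (σ i ≠ 1 → ∑ j, a i j * r j ≤ 0))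
  let Cσ : (ι → SignType) → Finset (Fin k → ℕ) := fun σ =>
    (Fintype.piFinset (fun _ => Finset.range (bC + 1))).filter
      (fun c => c ∈ S ∧ ∀ i, SignType.sign (F c i) = σ i)
  let e := Fintype.equivFin (ι → SignType)
  let σof : ℕ → (ι → SignType) := fun j =>
    if h : j < Fintype.card (ι → SignType) then e.symm ⟨j, h⟩ else 0
  refine ⟨Finset.range (Fintype.card (ι → SignType)), fun j => Cσ (σof j), fun j => Pσ (σof j),
    ?_, ?_, ?_⟩
  · have h3 : Fintype.card SignType = 3 := by decide
    rw [Finset.card_range]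
    simp [h3]
  · intro j _
    constructor
    · rw [snorm_le_s8]
      intro p hp j
      simp only [Pσ, Finset.mem_filter, Fintype.mem_piFinset, Finset.mem_range] at hp
      exact Nat.lt_succ_iff.mp (hp.1 j)
    · rw [snorm_le_s8]
      intro p hp j
      simp only [Cσ, Finset.mem_filter, Fintype.mem_piFinset, Finset.mem_range] at hp
      exact Nat.lt_succ_iff.mp (hp.1 j)
  have hunion : (⋃ j ∈ Finset.range (Fintype.card (ι → SignType)), LSet (Cσ (σof j)) (Pσ (σof j))) =
      ⋃ σ, LSet (Cσ σ) (Pσ σ) := by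
    ext v
    simp only [Set.mem_iUnion, Finset.mem_range, exists_prop]
    constructor
    · rintro ⟨j, -, h⟩; exact ⟨_, h⟩
    · rintro ⟨σ, h⟩
      refine ⟨e σ, (e σ).2, ?_⟩
      have : σof (e σ) = σ := by
        simp only [σof]
        rw [dif_pos (e σ).2]
        exact e.symm_apply_apply σ
      rw [this]; exact h
  rw [hunion]
  apply Set.Subset.antisymm
  · -- decomposition of a point
    intro v hv
    set u := U v with hu
    let f : ι → ℚ := fun i => F v i
    let a' : (ι ⊕ ι) ⊕ Fin k → Fin k → ℤ := Sum.elim (Sum.elim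
      (fun i j => (if f i < 0 then -1 else 1) * a i j)
      (fun i j => (if 0 < f i then 1 else -1) * a i j)) (fun i j => B i j)
    let b' : (ι ⊕ ι) ⊕ Fin k → ℚ := Sum.elim (Sum.elim
      (fun i => (if f i < 0 then -1 else 1) * t i + min |f i| 1)
      (fun i => (if 0 < f i then 1 else -1) * t i + min |f i| 1)) (fun j => - (x0 j : ℚ))
    have dot1 : ∀ i (y : Fin k → ℚ), ∑ j, (a' (Sum.inl (Sum.inl i)) j : ℚ) * y j =
        (if f i < 0 then -1 else 1) * ∑ j, (a i j : ℚ) * y j := by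
      intro i y
      rw [Finset.mul_sum]
      refine Finset.sum_congr rfl fun j _ => ?_
      simp only [a', Sum.elim_inl]
      push_cast
      ring
    have dot2 : ∀ i (y : Fin k → ℚ), ∑ j, (a' (Sum.inl (Sum.inr i)) j : ℚ) * y j =
        (if 0 < f i then 1 else -1) * ∑ j, (a i j : ℚ) * y j := by
      intro i y
      rw [Finset.mul_sum]
      refine Finset.sum_congr rfl fun j _ => ?_
      simp only [a', Sum.elim_inl, Sum.elim_inr]
      push_cast
      ring
    have hfe : ∀ i, ∑ j, (a i j : ℚ) * u j = f i + t i := by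
      intro i; simp only [f, F, ← hu]; ring
    have htq : ∀ i, |(t i : ℚ)| + 1 ≤ β := fun i => by exact_mod_cast ht i
    have hsg : ∀ (s x y B : ℚ), (s = 1 ∨ s = -1) → |x| + 1 ≤ B → |s * x + min |y| 1| ≤ B := by
      intro s x y B hs hB
      have h1 : |min |y| 1| ≤ 1 := by
        rw [abs_of_nonneg (le_min (abs_nonneg _) zero_le_one)]; exact min_le_right _ _
      have h2 : |s * x| = |x| := by rcases hs with h | h <;> simp [h]
      exact (abs_add_le _ _).trans (by linarith)
    obtain ⟨w, r, μ, hdec, hμ, hrec, hw, hwb, hrb⟩ := poly_decomp a' N hN (by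
      rintro ((i | i) | i) j
      · simp only [a', Sum.elim_inl]
        split_ifs <;> simpa using ha i j
      · simp only [a', Sum.elim_inl, Sum.elim_inr]
        split_ifs <;> simpa using ha i j
      · simp only [a', Sum.elim_inr]
        exact (hBn i j).trans (by exact_mod_cast hnN)) b' (β : ℚ) (by
      rintro ((i | i) | i)
      · exact hsg _ _ _ _ (by split_ifs <;> simp) (htq i)
      · exact hsg _ _ _ _ (by split_ifs <;> simp) (htq i)
      · simp only [b', Sum.elim_inr, abs_neg, Nat.abs_cast]
        exact_mod_cast (hx i).trans hℓβ) (by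
      intro y hy
      apply hinj
      intro j
      exact hy (Sum.inr j)) u (by
      rintro ((i | i) | i)
      · rw [dot1, hfe]
        simp only [b', Sum.elim_inl]
        have := min_le_left |f i| 1
        split_ifs with h
        · rw [abs_of_neg h] at *; linarith
        · rw [abs_of_nonneg (not_lt.mp h)] at *; linarith
      · rw [dot2, hfe]
        simp only [b', Sum.elim_inl, Sum.elim_inr]
        have := min_le_left |f i| 1
        split_ifs with h
        · rw [abs_of_pos h] at *; linarith
        · rw [abs_of_nonpos (not_lt.mp h)] at *; linarith
      · have := hU v i
        simp only [a', b', Sum.elim_inr]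
        rw [this]
        have : (0 : ℚ) ≤ v i := by positivity
        linarith)
    have hDq : (0 : ℚ) < D := by exact_mod_cast hD
    let m : Fin (k + 1) → ℕ := fun s => ⌊μ s / D⌋₊
    have hm1 : ∀ s, (m s : ℚ) * D ≤ μ s := fun s => by
      rw [← le_div_iff₀ hDq]; exact Nat.floor_le (div_nonneg (hμ s) hDq.le)
    have hm2 : ∀ s, μ s ≤ m s * D + D := fun s => by
      have := (Nat.lt_floor_add_one (μ s / D)).le
      rw [div_le_iff₀ hDq] at this
      linarith
    let u' : Fin k → ℚ := fun l => w l + ∑ s, (μ s - m s * D) * r s l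
    have hu'u : ∀ l, u l = u' l + D * ∑ s, (m s : ℚ) * r s l := by
      intro l
      rw [hdec l]
      simp only [u', add_assoc, Finset.mul_sum]
      rw [← Finset.sum_add_distrib]
      congr 1
      exact Finset.sum_congr rfl fun s _ => by ring
    have hu'c : ∀ o, b' o ≤ ∑ j, (a' o j : ℚ) * u' j := by
      intro o
      refine (hw o).trans ?_
      have h1 : ∑ j, (a' o j : ℚ) * u' j = ∑ j, (a' o j : ℚ) * w j +
          ∑ s, (μ s - m s * D) * ∑ j, (a' o j : ℚ) * r s j := by
        simp only [u', mul_add, Finset.sum_add_distrib, Finset.mul_sum]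
        congr 1
        rw [Finset.sum_comm]
        exact Finset.sum_congr rfl fun s _ => Finset.sum_congr rfl fun j _ => by ring
      rw [h1]
      have h2 : 0 ≤ ∑ s, (μ s - m s * D) * ∑ j, (a' o j : ℚ) * r s j := by
        refine Finset.sum_nonneg fun s _ => mul_nonneg (by linarith [hm1 s]) ?_
        exact_mod_cast hrec s o
      linarith
    have hu'b : ∀ l, |u' l| ≤ k * R * β + (k + 1) * (D * R) := by
      intro l
      refine (abs_add_le _ _).trans (add_le_add (by simpa [hR] using hwb l) ?_)
      refine (Finset.abs_sum_le_sum_abs _ _).trans ?_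
      refine (Finset.sum_le_card_nsmul _ _ ((D : ℚ) * R) ?_).trans (by simp)
      intro s _
      rw [abs_mul, abs_of_nonneg (by linarith [hm1 s])]
      have h3 : |(r s l : ℚ)| ≤ R := by exact_mod_cast hrb s l
      exact mul_le_mul (by linarith [hm2 s]) h3 (abs_nonneg _) hDq.le
    have hBabs : ∀ j (y : Fin k → ℚ) (Y : ℚ), (∀ l, |y l| ≤ Y) →
        ∑ l, (B j l : ℚ) * y l ≤ k * nB * Y := by
      intro j y Y hY
      refine (Finset.sum_le_card_nsmul _ _ ((nB : ℚ) * Y) ?_).trans (by simp [mul_assoc])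
      intro l _
      refine (le_abs_self _).trans ?_
      rw [abs_mul]
      have h3 : |(B j l : ℚ)| ≤ nB := by exact_mod_cast hBn j l
      exact mul_le_mul h3 (hY l) (abs_nonneg _) (by positivity)
    -- the periods
    have hpz : ∀ s j, 0 ≤ ∑ l, B j l * r s l := fun s j => hrec s (Sum.inr j)
    let p : Fin (k + 1) → Fin k → ℕ := fun s j => (D * ∑ l, B j l * r s l).toNat
    have hp : ∀ s j, (p s j : ℤ) = D * ∑ l, B j l * r s l := fun s j =>
      Int.toNat_of_nonneg (mul_nonneg (by positivity) (hpz s j))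
    have hpb : ∀ s j, p s j ≤ bP := by
      intro s j
      have h1 := hBabs j (fun l => (r s l : ℚ)) R (fun l => by exact_mod_cast hrb s l)
      have h2 : (p s j : ℚ) = D * ∑ l, (B j l : ℚ) * r s l := by exact_mod_cast hp s j
      have h3 : (p s j : ℚ) ≤ bP := by
        rw [h2, hbP]; push_cast
        exact mul_le_mul_of_nonneg_left h1 hDq.le
      exact_mod_cast h3
    -- the base point
    let η : Fin k → ℤ := fun l => - ∑ s, (m s : ℤ) * r s l
    let cz : Fin k → ℤ := fun j => v j + D * ∑ l, B j l * η l
    have hcz : ∀ j, (cz j : ℚ) = x0 j + ∑ l, (B j l : ℚ) * u' l := by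
      intro j
      have h1 := hU v j
      have h2 : ∑ l, (B j l : ℚ) * u l = ∑ l, (B j l : ℚ) * u' l -
          D * ∑ l, (B j l : ℚ) * η l := by
        rw [Finset.mul_sum, ← Finset.sum_sub_distrib]
        refine Finset.sum_congr rfl fun l _ => ?_
        rw [hu'u l]
        simp only [η]
        push_cast
        ring
      simp only [cz]
      push_cast
      linarith
    have hcz0 : ∀ j, 0 ≤ cz j := by
      intro j
      have h1 : -(x0 j : ℚ) ≤ ∑ l, (B j l : ℚ) * u' l := hu'c (Sum.inr j)
      have h2 : (0 : ℚ) ≤ cz j := by rw [hcz]; linarith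
      exact_mod_cast h2
    let c : Fin k → ℕ := fun j => (cz j).toNat
    have hc : ∀ j, (c j : ℤ) = cz j := fun j => Int.toNat_of_nonneg (hcz0 j)
    have hcq : ∀ j, (c j : ℚ) = cz j := fun j => by exact_mod_cast hc j
    have hUc : U c = u' := huniq c u' (fun j => by rw [hcq, hcz]; ring)
    have hcb : ∀ j, c j ≤ bC := by
      intro j
      have h1 := hBabs j u' _ hu'b
      have h2 : (x0 j : ℚ) ≤ ℓ := by exact_mod_cast hx j
      have h3 : (c j : ℚ) ≤ bC := by
        rw [hcq, hcz, hbC]; push_cast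
        linarith
      exact_mod_cast h3
    have hsign : ∀ i, SignType.sign (F c i) = SignType.sign (F v i) := by
      intro i
      have h1 := hu'c (Sum.inl (Sum.inl i))
      have h2 := hu'c (Sum.inl (Sum.inr i))
      rw [dot1] at h1
      rw [dot2] at h2
      simp only [b', Sum.elim_inl, Sum.elim_inr] at h1 h2
      apply sign_eq_of
      · simp only [F, hUc]
        rw [mul_sub]
        simp only [f] at h1
        linarith
      · simp only [F, hUc]
        rw [mul_sub]
        simp only [f] at h2
        linarith
    have hcS : c ∈ S := hS v c η hc hsign hv
    refine Set.mem_iUnion.mpr ⟨fun i => SignType.sign (F v i), ?_⟩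
    have hvc : v = c + ∑ s, m s • p s := by
      ext j
      have : (v j : ℤ) = c j + ∑ s, (m s : ℤ) * p s j := by
        rw [hc j]
        simp only [cz, hp, η]
        have : ∑ l, B j l * -∑ s, (m s : ℤ) * r s l = - ∑ s, (m s : ℤ) * ∑ l, B j l * r s l := by
          simp only [mul_neg, Finset.sum_neg_distrib, Finset.mul_sum]
          rw [Finset.sum_comm]
          congr 1
          exact Finset.sum_congr rfl fun s _ => Finset.sum_congr rfl fun l _ => by ring
        rw [this]
        have h4 : ∑ s, (m s : ℤ) * (D * ∑ l, B j l * r s l) =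
            D * ∑ s, (m s : ℤ) * ∑ l, B j l * r s l := by
          rw [Finset.mul_sum]
          exact Finset.sum_congr rfl fun s _ => by ring
        rw [h4]; ring
      simp only [Pi.add_apply, Finset.sum_apply, Pi.smul_apply, smul_eq_mul]
      exact_mod_cast this
    rw [hvc]
    apply mem_LSet_of_sum
    · simp only [Cσ, Finset.mem_filter, Fintype.mem_piFinset, Finset.mem_range]
      refine ⟨fun j => Nat.lt_succ_of_le (hcb j), hcS, fun i => ?_⟩
      rw [← hvc]; exact hsign i
    · intro s
      simp only [Pσ, Finset.mem_filter, Fintype.mem_piFinset, Finset.mem_range]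
      refine ⟨fun j => Nat.lt_succ_of_le (hpb s j), r s, hp s, fun i => ?_⟩
      rw [← hvc]
      have e1 : ((∑ j, a i j * r s j : ℤ) : ℚ) = ∑ j, (a i j : ℚ) * r s j := by push_cast; rfl
      constructor
      · intro hne
        have h1 : (0 : ℚ) ≤ ∑ j, (a' (Sum.inl (Sum.inl i)) j : ℚ) * r s j := by
          exact_mod_cast hrec s (Sum.inl (Sum.inl i))
        rw [dot1] at h1
        have : ¬ f i < 0 := fun h => hne (sign_neg h)
        rw [if_neg this, one_mul, ← e1] at h1
        exact_mod_cast h1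
      · intro hne
        have h1 : (0 : ℚ) ≤ ∑ j, (a' (Sum.inl (Sum.inr i)) j : ℚ) * r s j := by
          exact_mod_cast hrec s (Sum.inl (Sum.inr i))
        rw [dot2] at h1
        have : ¬ 0 < f i := fun h => hne (sign_pos h)
        rw [if_neg this, ← e1] at h1
        have h2 : ((∑ j, a i j * r s j : ℤ) : ℚ) ≤ 0 := by linarith
        exact_mod_cast h2
  · -- soundness
    refine Set.iUnion_subset fun σ => ?_
    rintro v ⟨c, hc, lam, hv⟩
    simp only [Cσ, Finset.mem_filter, Fintype.mem_piFinset, Finset.mem_range] at hc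
    obtain ⟨-, hcS, hcσ⟩ := hc
    have hP : ∀ p ∈ Pσ σ, ∃ r : Fin k → ℤ, (∀ j, (p j : ℤ) = D * ∑ l, B j l * r l) ∧
        ∀ i, (σ i ≠ -1 → 0 ≤ ∑ j, a i j * r j) ∧ (σ i ≠ 1 → ∑ j, a i j * r j ≤ 0) :=
      fun p hp => (Finset.mem_filter.mp hp).2
    choose! r hr1 hr2 using hP
    let η : Fin k → ℤ := fun l => ∑ p ∈ Pσ σ, (lam p : ℤ) * r p l
    have hη : ∀ (y : Fin k → ℤ), ∑ l, y l * η l = ∑ p ∈ Pσ σ, (lam p : ℤ) * ∑ l, y l * r p l := by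
      intro y
      simp only [η, Finset.mul_sum]
      rw [Finset.sum_comm]
      exact Finset.sum_congr rfl fun s _ => Finset.sum_congr rfl fun j _ => by ring
    have hvη : ∀ j, (v j : ℤ) = c j + D * ∑ l, B j l * η l := by
      intro j
      rw [hη, hv, Finset.mul_sum]
      simp only [Pi.add_apply, Finset.sum_apply, Pi.smul_apply, smul_eq_mul]
      push_cast
      congr 1
      refine Finset.sum_congr rfl fun p hp => ?_
      rw [hr1 p hp]; ring
    refine hS c v η hvη ?_ hcS
    intro i
    have hsh := hshift c v η hvη
    have h1 : ∑ j, (a i j : ℚ) * U v j - t i = (∑ j, (a i j : ℚ) * U c j - t i) +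
        ((D * ∑ j, a i j * η j : ℤ) : ℚ) := by
      simp only [hsh, mul_add, Finset.sum_add_distrib]
      push_cast
      have : ∑ x, (a i x : ℚ) * (D * η x) = D * ∑ x, (a i x : ℚ) * η x := by
        rw [Finset.mul_sum]
        exact Finset.sum_congr rfl fun _ _ => by ring
      rw [this]; ring
    rw [h1]
    have hcσi : SignType.sign (∑ j, (a i j : ℚ) * U c j - t i) = σ i := hcσ i
    apply sign_add_compat
    · intro hne
      rw [hcσi] at hne
      have : 0 ≤ (D : ℤ) * ∑ j, a i j * η j := by
        rw [hη]
        exact mul_nonneg (by positivity) (Finset.sum_nonneg fun p hp =>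
          mul_nonneg (by positivity) ((hr2 p hp i).1 hne))
      exact_mod_cast this
    · intro hne
      rw [hcσi] at hne
      have : (D : ℤ) * ∑ j, a i j * η j ≤ 0 := by
        rw [hη]
        exact mul_nonpos_of_nonneg_of_nonpos (by positivity) (Finset.sum_nonpos fun p hp =>
          mul_nonpos_of_nonneg_of_nonpos (by positivity) ((hr2 p hp i).2 hne))
      exact_mod_cast this

lemma exists_basis {k : ℕ} (P : Finset (Fin k → ℕ)) (hP : LinIndep P) (n : ℕ) (hn : snorm P ≤ n) :
    ∃ (B : Matrix (Fin k) (Fin k) ℤ) (T : Set (Fin k)), B.det ≠ 0 ∧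
      (∀ i j, |B i j| ≤ ((n + 1 : ℕ) : ℤ)) ∧
      ∀ x v : Fin k → ℕ, v ∈ LSet1 x P ↔ ∃ lam : Fin k → ℤ,
        (∀ j, (v j : ℤ) = x j + ∑ l, B j l * lam l) ∧
        ∀ l, (l ∈ T → 0 ≤ lam l) ∧ (l ∉ T → lam l = 0) := by
  classical
  obtain ⟨f, hf, hft, hPf, hdet⟩ := exists_rows (ι := Fin k → ℕ) (fun p j => (p j : ℤ))
    (P : Set (Fin k → ℕ)) (P ∪ Set.range (fun j : Fin k => Pi.single j 1)) (by
      have : LinearIndepOn ℚ (fun (p : Fin k → ℕ) (j : Fin k) => (p j : ℚ)) (P : Set (Fin k → ℕ)) := hP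
      simpa using this) Set.subset_union_left (by
      intro y hy
      ext j
      have := hy (Pi.single j 1) (Or.inr ⟨j, rfl⟩)
      simpa [Pi.single_apply] using this)
  have hsum : ∀ g : (Fin k → ℕ) → ℤ, ∑ x ∈ P, g x = ∑ l, if f l ∈ P then g (f l) else 0 := by
    intro g
    have hPi : P = (Finset.univ.filter (fun l => f l ∈ P)).image f := by
      ext x
      simp only [Finset.mem_image, Finset.mem_filter, Finset.mem_univ, true_and]
      constructor
      · intro hx
        obtain ⟨l, hl⟩ := hPf hx
        exact ⟨l, by rw [hl]; exact hx, hl⟩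
      · rintro ⟨l, hl, rfl⟩; exact hl
    conv_lhs => rw [hPi]
    rw [Finset.sum_image (fun a _ b _ h => hf h), Finset.sum_filter]
  refine ⟨(Matrix.of fun i j => (f i j : ℤ)).transpose, {l | f l ∈ P}, ?_, ?_, ?_⟩
  · rw [Matrix.det_transpose]; exact hdet
  · intro i j
    simp only [Matrix.transpose_apply, Matrix.of_apply, Nat.abs_cast]
    rcases hft j with h | ⟨l, h⟩
    · have := (snorm_le_s8 P n).mp hn _ h i
      exact_mod_cast this.trans (Nat.le_succ n)
    · rw [← h]
      simp only [Pi.single_apply]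
      split_ifs <;> (push_cast; linarith)
  · intro x v
    simp only [LSet1, LSet, Set.mem_ofPred_eq, Finset.mem_singleton, exists_eq_left,
      Matrix.transpose_apply, Matrix.of_apply]
    constructor
    · rintro ⟨lam, rfl⟩
      refine ⟨fun l => if f l ∈ P then (lam (f l) : ℤ) else 0, ?_, ?_⟩
      · intro j
        simp only [Pi.add_apply, Finset.sum_apply, Pi.smul_apply, smul_eq_mul]
        push_cast
        rw [hsum]
        congr 1
        refine Finset.sum_congr rfl fun l _ => ?_
        split_ifs <;> ring
      · intro l
        refine ⟨fun h => ?_, fun h => ?_⟩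
        · have h' : f l ∈ P := h
          simp [h']
        · have h' : f l ∉ P := h
          simp [h']
    · rintro ⟨lam, hlam, hT⟩
      refine ⟨Function.extend f (fun l => (lam l).toNat) 0, ?_⟩
      ext j
      have : (v j : ℤ) = x j + ∑ y ∈ P, ((Function.extend f (fun l => (lam l).toNat) 0 y : ℕ) : ℤ) * y j := by
        rw [hlam j, hsum]
        congr 1
        refine Finset.sum_congr rfl fun l _ => ?_
        rw [hf.extend_apply]
        split_ifs with h
        · rw [Int.toNat_of_nonneg ((hT l).1 h)]; ring
        · rw [(hT l).2 h, mul_zero]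
      simp only [Pi.add_apply, Finset.sum_apply, Pi.smul_apply, smul_eq_mul]
      exact_mod_cast this

lemma mem_transfer {k : ℕ} (B : Matrix (Fin k) (Fin k) ℤ) (hB : B.det ≠ 0) (T : Set (Fin k))
    (x v v' : Fin k → ℕ) (η : Fin k → ℤ) (hη : ∀ j, (v' j : ℤ) = v j + ∑ l, B j l * η l)
    (y y' : Fin k → ℚ) (hy : ∀ j, ∑ l, (B j l : ℚ) * y l = (v j : ℚ) - x j)
    (hy' : ∀ j, ∑ l, (B j l : ℚ) * y' l = (v' j : ℚ) - x j)
    (hs : ∀ l, SignType.sign (y' l) = SignType.sign (y l))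
    (h : ∃ lam : Fin k → ℤ, (∀ j, (v j : ℤ) = x j + ∑ l, B j l * lam l) ∧
        ∀ l, (l ∈ T → 0 ≤ lam l) ∧ (l ∉ T → lam l = 0)) :
    ∃ lam : Fin k → ℤ, (∀ j, (v' j : ℤ) = x j + ∑ l, B j l * lam l) ∧
        ∀ l, (l ∈ T → 0 ≤ lam l) ∧ (l ∉ T → lam l = 0) := by
  obtain ⟨lam, h1, h2⟩ := h
  have hd : (B.det : ℚ) ≠ 0 := by exact_mod_cast hB
  have huniq : ∀ (z z' : Fin k → ℚ), (∀ j, ∑ l, (B j l : ℚ) * z l = ∑ l, (B j l : ℚ) * z' l) →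
      ∀ l, z l = z' l := by
    intro z z' hz l
    have e1 := cramer_eq B z _ hz l
    have e2 := cramer_eq B z' _ (fun _ => rfl) l
    exact mul_left_cancel₀ hd (e1.trans e2.symm)
  have h1' : ∀ j, (v' j : ℤ) = x j + ∑ l, B j l * (lam l + η l) := by
    intro j
    simp only [mul_add, Finset.sum_add_distrib]
    rw [hη, h1]; ring
  have hyl : ∀ l, y l = lam l := huniq y (fun l => lam l) (fun j => by
    rw [hy]
    have : (v j : ℚ) = x j + ∑ l, (B j l : ℚ) * lam l := by exact_mod_cast h1 j
    rw [this]; ring)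
  have hyl' : ∀ l, y' l = ((lam l + η l : ℤ) : ℚ) := huniq y' (fun l => ((lam l + η l : ℤ) : ℚ)) (fun j => by
    rw [hy']
    have : (v' j : ℚ) = x j + ∑ l, (B j l : ℚ) * ((lam l + η l : ℤ) : ℚ) := by exact_mod_cast h1' j
    rw [this]; ring)
  refine ⟨fun l => lam l + η l, h1', fun l => ⟨fun hl => ?_, fun hl => ?_⟩⟩
  · have h3 : (0 : ℚ) ≤ y l := by rw [hyl]; exact_mod_cast (h2 l).1 hl
    have h4 : (0 : ℚ) ≤ y' l := by
      rw [← sign_nonneg_iff, hs l, sign_nonneg_iff]; exact h3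
    rw [hyl'] at h4; exact_mod_cast h4
  · have h3 : y l = 0 := by rw [hyl]; exact_mod_cast (h2 l).2 hl
    have h4 : y' l = 0 := by
      rw [← sign_eq_zero_iff, hs l, sign_eq_zero_iff]; exact h3
    rw [hyl'] at h4; exact_mod_cast h4

lemma solve_eq {k : ℕ} (B : Matrix (Fin k) (Fin k) ℤ) (hB : B.det ≠ 0) (z : Fin k → ℚ) (j : Fin k) :
    ∑ l, (B j l : ℚ) * ((∑ i, (B.adjugate l i : ℚ) * z i) / B.det) = z j := by
  have hd : (B.det : ℚ) ≠ 0 := by exact_mod_cast hB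
  have h1 : ∀ i, ∑ l, (B j l : ℚ) * B.adjugate l i = if j = i then (B.det : ℚ) else 0 := by
    intro i
    have := congrFun (congrFun (Matrix.mul_adjugate B) j) i
    rw [Matrix.mul_apply] at this
    have h2 : ((∑ l, B j l * B.adjugate l i : ℤ) : ℚ) = ((B.det • (1 : Matrix (Fin k) (Fin k) ℤ)) j i : ℤ) := by
      rw [this]
    push_cast at h2
    rw [h2]
    simp [Matrix.one_apply]
  simp only [← mul_div_assoc, ← Finset.sum_div, Finset.mul_sum]
  rw [Finset.sum_comm]
  simp only [← mul_assoc, ← Finset.sum_mul, h1]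
  simp [hd]

lemma fact_pow_le (k N : ℕ) : k.factorial * N ^ k ≤ (k * N) ^ k := by
  rw [mul_pow]; exact Nat.mul_le_mul_right _ (Nat.factorial_le_pow k)

lemma arith1 (k n ℓ : ℕ) (hk : 1 ≤ k) :
    3 ^ k ≤ (4 * k * (n + 1)) ^ (5 * (k + 2) * (3 * k + 2) ^ (0 + 1)) * (ℓ + 1) ^ (k * 2 ^ (0 + 1)) ∧
    1 * (k * (n + 1) * (k.factorial * (n + 1) ^ k)) ≤ (4 * k * (n + 1)) ^ ((k + 2) * (3 * k + 1) ^ 0) ∧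
    ℓ + k * (n + 1) * (k * (k.factorial * (n + 1) ^ k) * (ℓ + 1) +
          (k + 1) * (1 * (k.factorial * (n + 1) ^ k))) ≤
      (4 * k * (n + 1)) ^ ((k + 2) * (3 * k + 2) ^ 0 + k) * (ℓ + 1) := by
  obtain ⟨m, hm⟩ : ∃ m, m = k * (n + 1) := ⟨_, rfl⟩
  have hkm : k ≤ m := by rw [hm]; nlinarith
  have hM : 4 * k * (n + 1) = 4 * m := by rw [hm]; ring
  have hM1 : 1 ≤ 4 * m := by omega
  rw [hM, ← hm]
  have hR := fact_pow_le k (n + 1)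
  rw [← hm] at hR
  generalize k.factorial * (n + 1) ^ k = R at *
  refine ⟨?_, ?_, ?_⟩
  · calc 3 ^ k ≤ (4 * m) ^ k := Nat.pow_le_pow_left (by omega) k
      _ ≤ (4 * m) ^ (5 * (k + 2) * (3 * k + 2) ^ (0 + 1)) :=
        Nat.pow_le_pow_right hM1 (by rw [zero_add, pow_one]; nlinarith)
      _ ≤ _ := Nat.le_mul_of_pos_right _ (by positivity)
  · calc 1 * (m * R) ≤ m * m ^ k := by rw [one_mul]; gcongr
      _ = m ^ (k + 1) := by ring
      _ ≤ (4 * m) ^ (k + 1) := Nat.pow_le_pow_left (by omega) _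
      _ ≤ _ := Nat.pow_le_pow_right hM1 (by rw [pow_zero, mul_one]; omega)
  · have h1 : 1 ≤ m ^ (k + 1) := Nat.one_le_pow _ _ (by omega)
    calc ℓ + m * (k * R * (ℓ + 1) + (k + 1) * (1 * R))
        ≤ ℓ + m * (k * m ^ k * (ℓ + 1) + (k + 1) * (1 * m ^ k)) := by gcongr
      _ = ℓ + m ^ (k + 1) * (k * (ℓ + 1) + (k + 1)) := by ring
      _ ≤ m ^ (k + 1) * (ℓ + 1) + m ^ (k + 1) * (k * (ℓ + 1) + (k + 1) * (ℓ + 1)) := by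
        have : ℓ ≤ m ^ (k + 1) * (ℓ + 1) := by nlinarith
        have : m ^ (k + 1) * (k * (ℓ + 1) + (k + 1)) ≤
            m ^ (k + 1) * (k * (ℓ + 1) + (k + 1) * (ℓ + 1)) := by
          gcongr; nlinarith
        omega
      _ = m ^ (k + 1) * (2 * k + 2) * (ℓ + 1) := by ring
      _ ≤ m ^ (k + 1) * (4 * m) * (ℓ + 1) := by gcongr; omega
      _ ≤ (4 * m) ^ (k + 1) * (4 * m) * (ℓ + 1) := by gcongr; omega
      _ = (4 * m) ^ (k + 2) * (ℓ + 1) := by ring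
      _ ≤ _ := Nat.mul_le_mul_right _ (Nat.pow_le_pow_right hM1 (by
          rw [pow_zero, mul_one]; omega))

lemma pow_aux (k q : ℕ) (hk : 1 ≤ k) (hq : 1 ≤ q) : 2 ^ q + 3 * k ≤ (3 * k + 1) ^ q + 1 := by
  obtain ⟨p, rfl⟩ : ∃ p, q = p + 1 := ⟨q - 1, by omega⟩
  have h1 : 2 ^ p ≤ (3 * k + 1) ^ p := Nat.pow_le_pow_left (by omega) p
  have h2 : 1 ≤ 2 ^ p := Nat.one_le_two_pow
  rw [pow_succ, pow_succ]
  nlinarith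

lemma arith2 (k n ℓ q D c N : ℕ) (hk : 1 ≤ k) (hq : 1 ≤ q) (hc : c ≤ 2 ^ q)
    (hN : N = k.factorial * (n + 1) ^ k) (hD : D ≤ N ^ c) :
    3 ^ (c * k) ≤ (4 * k * (n + 1)) ^ (5 * (k + 2) * (3 * k + 2) ^ (q + 1)) *
      (ℓ + 1) ^ (k * 2 ^ (q + 1)) ∧
    D * (k * 1 * (k.factorial * N ^ k)) ≤ (4 * k * (n + 1)) ^ ((k + 2) * (3 * k + 1) ^ q) ∧
    0 + k * 1 * (k * (k.factorial * N ^ k) * (k * N * ℓ + 1) +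
          (k + 1) * (D * (k.factorial * N ^ k))) ≤
      (4 * k * (n + 1)) ^ ((k + 2) * (3 * k + 2) ^ q + k) * (ℓ + 1) := by
  obtain ⟨m, hm⟩ : ∃ m, m = k * (n + 1) := ⟨_, rfl⟩
  have hkm : k ≤ m := by rw [hm]; nlinarith
  have hM : 4 * k * (n + 1) = 4 * m := by rw [hm]; ring
  have hM1 : 1 ≤ 4 * m := by omega
  have hm1 : 1 ≤ m := by omega
  rw [hM]
  have hNm : N ≤ m ^ k := by
    have := fact_pow_le k (n + 1)
    rw [← hm] at this; omega
  have hN1 : 1 ≤ N := by rw [hN]; exact Nat.mul_pos (Nat.factorial_pos _) (by positivity)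
  have hDm : D ≤ m ^ (k * 2 ^ q) := by
    calc D ≤ N ^ c := hD
      _ ≤ (m ^ k) ^ c := Nat.pow_le_pow_left hNm c
      _ ≤ (m ^ k) ^ (2 ^ q) := Nat.pow_le_pow_right (Nat.one_le_pow _ _ hm1) hc
      _ = _ := by rw [← pow_mul]
  have hR : k.factorial * N ^ k ≤ m ^ (k * k + k) := by
    calc k.factorial * N ^ k ≤ (k * N) ^ k := fact_pow_le k N
      _ ≤ (m * m ^ k) ^ k := by gcongr
      _ = _ := by ring
  generalize k.factorial * N ^ k = R at *
  have hpa := pow_aux k q hk hq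
  have h32 : (3 * k + 1) ^ q ≤ (3 * k + 2) ^ q := Nat.pow_le_pow_left (by omega) q
  have hq2 : 1 ≤ 2 ^ q := Nat.one_le_two_pow
  refine ⟨?_, ?_, ?_⟩
  · calc 3 ^ (c * k) ≤ (4 * m) ^ (c * k) := Nat.pow_le_pow_left (by omega) _
      _ ≤ (4 * m) ^ (5 * (k + 2) * (3 * k + 2) ^ (q + 1)) := by
        refine Nat.pow_le_pow_right hM1 ?_
        have : c ≤ (3 * k + 2) ^ (q + 1) := by
          rw [pow_succ]; nlinarith
        nlinarith
      _ ≤ _ := Nat.le_mul_of_pos_right _ (by positivity)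
  · calc D * (k * 1 * R) ≤ m ^ (k * 2 ^ q) * (m * 1 * m ^ (k * k + k)) := by gcongr
      _ = m ^ (k * 2 ^ q + k * k + k + 1) := by ring
      _ ≤ (4 * m) ^ (k * 2 ^ q + k * k + k + 1) := Nat.pow_le_pow_left (by omega) _
      _ ≤ _ := by
        refine Nat.pow_le_pow_right hM1 ?_
        nlinarith
  · have e1 : k * N * ℓ + 1 ≤ m * m ^ k * (ℓ + 1) := by
      have : k * N ≤ m * m ^ k := by gcongr
      have : 1 ≤ m * m ^ k := Nat.mul_pos hm1 (by positivity)
      nlinarith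
    set E := k * 2 ^ q + k * k + k with hE
    have hkk : k ≤ k * 2 ^ q := by nlinarith
    calc 0 + k * 1 * (k * R * (k * N * ℓ + 1) + (k + 1) * (D * R))
        ≤ 0 + m * 1 * (m * m ^ (k * k + k) * (m * m ^ k * (ℓ + 1)) +
          (m + 1) * (m ^ (k * 2 ^ q) * m ^ (k * k + k))) := by gcongr
      _ = m ^ (k * k + k + k + 3) * (ℓ + 1) + (m + 1) * m ^ (E + 1) := by rw [hE]; ring
      _ ≤ m ^ (E + 3) * (ℓ + 1) + (m + m) * m ^ (E + 1) * (ℓ + 1) := by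
        refine Nat.add_le_add ?_ ?_
        · refine Nat.mul_le_mul_right _ (Nat.pow_le_pow_right hm1 ?_)
          omega
        · refine le_trans ?_ (Nat.le_mul_of_pos_right _ (by positivity))
          gcongr
      _ = (m ^ (E + 3) + 2 * m ^ (E + 2)) * (ℓ + 1) := by ring
      _ ≤ (m ^ (E + 3) + 2 * m ^ (E + 3)) * (ℓ + 1) := by
        have : m ^ (E + 2) ≤ m ^ (E + 3) := Nat.pow_le_pow_right hm1 (by omega)
        gcongr
      _ = 3 * m ^ (E + 3) * (ℓ + 1) := by ring
      _ ≤ 4 ^ (E + 3) * m ^ (E + 3) * (ℓ + 1) := by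
        have : 3 ≤ 4 ^ (E + 3) := by
          calc 3 ≤ 4 ^ 1 := by norm_num
            _ ≤ _ := Nat.pow_le_pow_right (by norm_num) (by omega)
        gcongr
      _ = (4 * m) ^ (E + 3) * (ℓ + 1) := by rw [mul_pow]
      _ ≤ _ := Nat.mul_le_mul_right _ (Nat.pow_le_pow_right hM1 (by
          have h5 : (k + 2) * (2 ^ q + 3 * k) ≤ (k + 2) * ((3 * k + 2) ^ q + 1) :=
            Nat.mul_le_mul_left _ (by omega)
          have h6 : 2 ≤ 2 ^ q := by
            calc 2 = 2 ^ 1 := by norm_num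
              _ ≤ 2 ^ q := Nat.pow_le_pow_right (by norm_num) hq
          rw [hE]; nlinarith))

lemma int_solve {k : ℕ} (B : Matrix (Fin k) (Fin k) ℤ) (η : Fin k → ℤ) (e : ℤ) (j : Fin k) :
    ∑ l, B j l * (-(e * ∑ i, B.adjugate l i * η i)) = -(B.det * e * η j) := by
  have h : B.mulVec (B.adjugate.mulVec η) = B.det • η := by
    rw [Matrix.mulVec_mulVec, Matrix.mul_adjugate, Matrix.smul_mulVec, Matrix.one_mulVec]
  have h1 := congrFun h j
  simp only [Matrix.mulVec, dotProduct, Pi.smul_apply, smul_eq_mul] at h1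
  calc ∑ l, B j l * (-(e * ∑ i, B.adjugate l i * η i))
      = -(e * ∑ l, B j l * ∑ i, B.adjugate l i * η i) := by
        rw [Finset.mul_sum, ← Finset.sum_neg_distrib]
        exact Finset.sum_congr rfl fun l _ => by ring
    _ = _ := by rw [h1]; ring

/-- One linear set. -/
lemma case_one {k : ℕ} (hk : 1 ≤ k) (x : Fin k → ℕ) (P : Finset (Fin k → ℕ)) (hP : LinIndep P)
    (n ℓ : ℕ) (hn : snorm P ≤ n) (hℓ : vnorm x ≤ ℓ) :
    ∃ (J : Finset ℕ) (C' P' : ℕ → Finset (Fin k → ℕ)),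
      J.card ≤ (4 * k * (n + 1)) ^ (5 * (k + 2) * (3 * k + 2) ^ (0 + 1)) *
        (ℓ + 1) ^ (k * 2 ^ (0 + 1)) ∧
      (∀ j ∈ J,
        snorm (P' j) ≤ (4 * k * (n + 1)) ^ ((k + 2) * (3 * k + 1) ^ 0) ∧
        snorm (C' j) ≤ (4 * k * (n + 1)) ^ ((k + 2) * (3 * k + 2) ^ 0 + k) * (ℓ + 1)) ∧
      (LSet1 x P)ᶜ = ⋃ j ∈ J, LSet (C' j) (P' j) := by
  obtain ⟨B, T, hB, hBn, hmem⟩ := exists_basis P hP n hn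
  obtain ⟨b1, b2, b3⟩ := arith1 k n ℓ hk
  have hU : ∀ (v : Fin k → ℕ) (j : Fin k), ∑ l, (B j l : ℚ) *
      ((∑ i, (B.adjugate l i : ℚ) * ((v i : ℚ) - x i)) / B.det) = (v j : ℚ) - x j :=
    fun v j => solve_eq B hB (fun i => (v i : ℚ) - x i) j
  obtain ⟨J, C', P', h1, h2, h3⟩ := general_rep (ι := Fin k) (LSet1 x P)ᶜ B hB x 1 one_pos
    (fun i j => (1 : Matrix (Fin k) (Fin k) ℤ) i j) (fun _ => 0) (n + 1) (n + 1) (ℓ + 1) ℓ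
    (by omega) hBn le_rfl
    (by
      intro i j
      rw [Matrix.one_apply]
      split_ifs
      · simp
      · simp; positivity)
    (by intro i; simp) ((vnorm_le x ℓ).1 hℓ) (by omega)
    (fun v l => (∑ i, (B.adjugate l i : ℚ) * ((v i : ℚ) - x i)) / B.det) hU
    (by
      intro v v' η hη hs hv hv'
      apply hv
      rw [hmem] at hv' ⊢
      refine mem_transfer B hB T x v' v (fun l => -η l) ?_ _ _ (hU v') (hU v) ?_ hv'
      · intro j
        rw [hη j]
        simp
      · intro l
        have := hs l
        simp only [Matrix.one_apply, Int.cast_ite, Int.cast_one, Int.cast_zero, ite_mul, one_mul,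
          zero_mul, Finset.sum_ite_eq, Finset.mem_univ, if_true, sub_zero] at this
        exact this.symm)
  refine ⟨J, C', P', ?_, ?_, h3⟩
  · rw [Fintype.card_fin] at h1
    exact h1.trans b1
  · intro j hj
    exact ⟨(h2 j hj).1.trans b2, (h2 j hj).2.trans b3⟩

/-- At least two linear sets. -/
lemma case_two {ι : Type*} {k : ℕ} (hk : 1 ≤ k) (I : Finset ι)
    (x : ι → (Fin k → ℕ)) (P : ι → Finset (Fin k → ℕ))
    (hind : ∀ i ∈ I, LinIndep (P i)) (n ℓ q : ℕ)
    (hn : ∀ i ∈ I, snorm (P i) ≤ n) (hℓ : ∀ i ∈ I, vnorm (x i) ≤ ℓ)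
    (hq : 1 ≤ q) (hc : I.card ≤ 2 ^ q) :
    ∃ (J : Finset ℕ) (C' P' : ℕ → Finset (Fin k → ℕ)),
      J.card ≤ (4 * k * (n + 1)) ^ (5 * (k + 2) * (3 * k + 2) ^ (q + 1)) *
        (ℓ + 1) ^ (k * 2 ^ (q + 1)) ∧
      (∀ j ∈ J,
        snorm (P' j) ≤ (4 * k * (n + 1)) ^ ((k + 2) * (3 * k + 1) ^ q) ∧
        snorm (C' j) ≤ (4 * k * (n + 1)) ^ ((k + 2) * (3 * k + 2) ^ q + k) * (ℓ + 1)) ∧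
      (⋃ i ∈ I, LSet1 (x i) (P i))ᶜ = ⋃ j ∈ J, LSet (C' j) (P' j) := by
  have hb := fun i : I => exists_basis (P i) (hind i i.2) n (hn i i.2)
  choose B T hB hBn hmem using hb
  obtain ⟨N, hN⟩ : ∃ N, N = k.factorial * (n + 1) ^ k := ⟨_, rfl⟩
  have hN1 : 1 ≤ N := by rw [hN]; exact Nat.mul_pos (Nat.factorial_pos _) (by positivity)
  obtain ⟨D, hDdef⟩ : ∃ D : ℕ, D = ∏ i : I, (B i).det.natAbs := ⟨_, rfl⟩
  have hD0 : 0 < D := by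
    rw [hDdef]
    exact Finset.prod_pos fun i _ => Int.natAbs_pos.2 (hB i)
  have hDN : D ≤ N ^ I.card := by
    rw [hDdef]
    have := Finset.prod_le_pow_card (Finset.univ : Finset I) (fun i => (B i).det.natAbs) N
      (by
        intro i _
        have := det_bd (B i) (n + 1) (hBn i)
        rw [← hN, Int.abs_eq_natAbs] at this
        show (B i).det.natAbs ≤ N
        omega)
    simpa using this
  have hdvd : ∀ i : I, ∃ e : ℤ, (D : ℤ) = (B i).det * e := by
    intro i
    have h1 : (B i).det.natAbs ∣ D := by
      rw [hDdef]; exact Finset.dvd_prod_of_mem _ (Finset.mem_univ i)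
    exact Int.natAbs_dvd.1 (Int.natCast_dvd_natCast.2 h1)
  obtain ⟨b1, b2, b3⟩ := arith2 k n ℓ q D I.card N hk hq hc hN hDN
  have hadj : ∀ (i : I) (l j : Fin k), |(B i).adjugate l j| ≤ (N : ℤ) := by
    intro i l j
    have := adj_bd (B i) (n + 1) (by omega) (hBn i) l j
    rw [← hN] at this
    exact this
  have hxb : ∀ (i : I) (j : Fin k), x i j ≤ ℓ := fun i => (vnorm_le (x i) ℓ).1 (hℓ i i.2)
  obtain ⟨J, C', P', h1, h2, h3⟩ := general_rep (ι := I × Fin k)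
    (⋃ i ∈ I, LSet1 (x i) (P i))ᶜ 1 (by simp) (fun _ => 0) D hD0
    (fun p j => (B p.1).adjugate p.2 j)
    (fun p => ∑ j, (B p.1).adjugate p.2 j * (x p.1 j : ℤ)) N 1 (k * N * ℓ + 1) 0
    hN1
    (by
      intro i j
      rw [Matrix.one_apply]
      split_ifs <;> simp)
    hN1 (fun p j => hadj p.1 p.2 j)
    (by
      intro p
      have : |∑ j, (B p.1).adjugate p.2 j * (x p.1 j : ℤ)| ≤ ∑ j : Fin k, (N : ℤ) * ℓ := by
        refine (Finset.abs_sum_le_sum_abs _ _).trans (Finset.sum_le_sum fun j _ => ?_)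
        rw [abs_mul]
        have h := hxb p.1 j
        have h' : |(x p.1 j : ℤ)| ≤ ℓ := by rw [abs_of_nonneg (by positivity)]; exact_mod_cast h
        exact mul_le_mul (hadj p.1 p.2 j) h' (abs_nonneg _) (by positivity)
      simp only [Finset.sum_const, Finset.card_univ, Fintype.card_fin, nsmul_eq_mul] at this
      push_cast
      linarith)
    (fun j => le_rfl) (Nat.zero_le _)
    (fun v l => (v l : ℚ))
    (by
      intro v j
      simp [Matrix.one_apply])
    (by
      intro v v' η hη hs hv hv'
      apply hv
      simp only [Set.mem_iUnion] at hv' ⊢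
      obtain ⟨i, hi, hvi⟩ := hv'
      refine ⟨i, hi, ?_⟩
      have hm := hmem ⟨i, hi⟩
      simp only at hm
      rw [hm] at hvi ⊢
      obtain ⟨e, he⟩ := hdvd ⟨i, hi⟩
      have hs' := fun l => hs (⟨i, hi⟩, l)
      simp only at hs'
      have hB' := hB ⟨i, hi⟩
      generalize B ⟨i, hi⟩ = A at *
      have hη2 : ∀ j, (v' j : ℤ) = v j + D * η j := by
        intro j
        rw [hη j]
        simp [Matrix.one_apply]
      refine mem_transfer A hB' _ (x i) v' v (fun l => -(e * ∑ i, A.adjugate l i * η i)) ?_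
        _ _ (solve_eq A hB' (fun j => (v' j : ℚ) - x i j))
        (solve_eq A hB' (fun j => (v j : ℚ) - x i j)) ?_ hvi
      · intro j
        rw [int_solve, hη2 j, he]
        ring
      · intro l
        have key : ∀ w : Fin k → ℕ, ∑ j, (A.adjugate l j : ℚ) * ((w j : ℚ) - x i j) =
            ∑ j, (A.adjugate l j : ℚ) * (w j : ℚ) -
              ((∑ j, A.adjugate l j * (x i j : ℤ) : ℤ) : ℚ) := by
          intro w
          push_cast
          simp only [mul_sub, Finset.sum_sub_distrib]
        rw [div_eq_mul_inv, div_eq_mul_inv, sign_mul, sign_mul, key v, key v', hs' l])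
  refine ⟨J, C', P', ?_, ?_, h3⟩
  · rw [Fintype.card_prod, Fintype.card_fin, Fintype.card_coe] at h1
    exact h1.trans b1
  · intro j hj
    exact ⟨(h2 j hj).1.trans b2, (h2 j hj).2.trans b3⟩

/-- Complement of a semilinear set with linearly independent period sets,
where `q = ⌈log₂ |I|⌉`. -/
theorem compl_semilinear_indep {ι : Type*} (k : ℕ) (hk : 1 ≤ k)
    (I : Finset ι) (hI : I.Nonempty)
    (x : ι → (Fin k → ℕ)) (P : ι → Finset (Fin k → ℕ))
    (hind : ∀ i ∈ I, LinIndep (P i))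
    (n ℓ q : ℕ)
    (hn : n = I.sup fun i => snorm (P i))
    (hℓ : ℓ = I.sup fun i => vnorm (x i))
    (hq : q = Nat.clog 2 I.card) :
    ∃ (J : Finset ℕ) (C' P' : ℕ → Finset (Fin k → ℕ)),
      J.card ≤ (4 * k * (n + 1)) ^ (5 * (k + 2) * (3 * k + 2) ^ (q + 1)) *
        (ℓ + 1) ^ (k * 2 ^ (q + 1)) ∧
      (∀ j ∈ J,
        snorm (P' j) ≤ (4 * k * (n + 1)) ^ ((k + 2) * (3 * k + 1) ^ q) ∧
        snorm (C' j) ≤ (4 * k * (n + 1)) ^ ((k + 2) * (3 * k + 2) ^ q + k) * (ℓ + 1)) ∧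
      (⋃ i ∈ I, LSet1 (x i) (P i))ᶜ = ⋃ j ∈ J, LSet (C' j) (P' j) := by
  have hn' : ∀ i ∈ I, snorm (P i) ≤ n := by
    intro i hi
    rw [hn]
    exact Finset.le_sup (f := fun i => snorm (P i)) hi
  have hℓ' : ∀ i ∈ I, vnorm (x i) ≤ ℓ := by
    intro i hi
    rw [hℓ]
    exact Finset.le_sup (f := fun i => vnorm (x i)) hi
  by_cases h1 : I.card = 1
  · obtain ⟨i, hi⟩ := Finset.card_eq_one.1 h1
    have hq0 : q = 0 := by rw [hq, h1]; simp
    have hiI : i ∈ I := by rw [hi]; simp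
    have := case_one hk (x i) (P i) (hind i hiI) n ℓ (hn' i hiI) (hℓ' i hiI)
    have hun : (⋃ i ∈ I, LSet1 (x i) (P i)) = LSet1 (x i) (P i) := by rw [hi]; simp
    rw [hun, hq0]
    exact this
  · have hc : 0 < I.card := hI.card_pos
    refine case_two hk I x P hind n ℓ q hn' hℓ' ?_ ?_
    · rw [hq]; exact Nat.clog_pos (by norm_num) (by omega)
    · rw [hq]; exact Nat.le_pow_clog (by norm_num) _
end

section
/- Let k ≥ 1 and let L(x₀, P) be a linear subset of ℕ^k; set m = |P| and n = ‖P‖. Then there exists an index set I with |I| ≤ (m+1)! · m! / 2^m · (k^{k/2} n^k + 1)^{m−1} and, for each i ∈ I, a linearly independent (over ℚ) finite subset P_i ⊆ ℕ^k with ‖P_i‖ ≤ n and a vector x_i ∈ ℕ^k with ‖x_i‖ ≤ ‖x₀‖ + (m+1)(m+2)/2 · k^{k/2} n^{k+1}, such that ⋃_{i ∈ I} L(x_i, P_i) = L(x₀, P). -/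
lemma aux_hadamard {k : ℕ} (n : ℕ) (A : Matrix (Fin k) (Fin k) ℤ)
    (hA : ∀ i j, |A i j| ≤ (n : ℤ)) :
    (|(A.det : ℝ)|) ≤ (k : ℝ) ^ ((k : ℝ) / 2) * (n : ℝ) ^ k := by
  have : Fact (Module.finrank ℝ (EuclideanSpace ℝ (Fin k)) = k) := ⟨by simp⟩
  let b := EuclideanSpace.basisFun (Fin k) ℝ
  let o : Orientation ℝ (EuclideanSpace ℝ (Fin k)) (Fin k) := b.toBasis.orientation
  let v : Fin k → EuclideanSpace ℝ (Fin k) := fun j => WithLp.toLp 2 (fun i => (A i j : ℝ))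
  have h1 := o.abs_volumeForm_apply_le v
  rw [o.volumeForm_robust' b] at h1
  have h2 : b.toBasis.det v = (A.det : ℝ) := by
    rw [Module.Basis.det_apply]
    have : b.toBasis.toMatrix v = A.map (Int.cast : ℤ → ℝ) := by
      ext i j
      simp [Module.Basis.toMatrix_apply, b, v]
    rw [this]
    exact (Int.cast_det A).symm
  rw [h2] at h1
  refine h1.trans ?_
  have h3 : ∀ j, ‖v j‖ ≤ Real.sqrt k * n := by
    intro j
    rw [EuclideanSpace.norm_eq]
    apply Real.sqrt_le_iff.mpr
    refine ⟨by positivity, ?_⟩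
    rw [mul_pow, Real.sq_sqrt (by positivity)]
    calc ∑ i, ‖(v j) i‖ ^ 2 ≤ ∑ i : Fin k, (n : ℝ) ^ 2 := by
          apply Finset.sum_le_sum
          intro i _
          have : ‖(v j) i‖ ≤ n := by
            have := hA i j
            simp only [v, Real.norm_eq_abs]
            exact_mod_cast this
          gcongr
      _ = _ := by simp
  calc ∏ i, ‖v i‖ ≤ ∏ i : Fin k, (Real.sqrt k * n) :=
        Finset.prod_le_prod (fun _ _ => norm_nonneg _) (fun i _ => h3 i)
    _ = _ := by
      rw [Finset.prod_const, mul_pow, Finset.card_fin, Real.sqrt_eq_rpow, ← Real.rpow_natCast (_ ^ _),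
        ← Real.rpow_mul (by positivity)]
      congr 2
      ring

/-- cast of a natural vector to a rational vector -/
def qv {k : ℕ} (x : Fin k → ℕ) : Fin k → ℚ := fun i => (x i : ℚ)

lemma le_snorm {k : ℕ} {P : Finset (Fin k → ℕ)} {x : Fin k → ℕ} (hx : x ∈ P) (i : Fin k) :
    x i ≤ snorm P :=
  (Finset.le_sup (f := x) (Finset.mem_univ i)).trans (Finset.le_sup (f := vnorm) hx)

lemma aux_relation {k : ℕ} (P : Finset (Fin k → ℕ)) (n : ℕ) (hn : snorm P ≤ n) (hn1 : 1 ≤ n)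
    (hP : ¬ LinIndep P) :
    ∃ c : (Fin k → ℕ) → ℤ, (∃ x ∈ P, c x ≠ 0) ∧
      (∀ x, |(c x : ℝ)| ≤ (k : ℝ) ^ ((k : ℝ) / 2) * (n : ℝ) ^ k) ∧
      ∀ i, ∑ x ∈ P, c x * (x i : ℤ) = 0 := by
  classical
  obtain ⟨s, hsP, -, hspan, hsind⟩ := exists_linearIndepOn_extension (K := ℚ)
    (v := (qv : (Fin k → ℕ) → (Fin k → ℚ))) (s := ∅) (t := (P : Set (Fin k → ℕ)))
    (linearIndepOn_empty _ _) (Set.empty_subset _)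
  have hne : ∃ y ∈ P, y ∉ s := by
    by_contra! hcon
    apply hP
    have : s = (P : Set (Fin k → ℕ)) := Set.Subset.antisymm hsP hcon
    rw [this] at hsind
    exact hsind
  obtain ⟨y, hyP, hys⟩ := hne
  obtain ⟨b, hbt, hsb, hbspan, hbind⟩ := exists_linearIndepOn_extension (K := ℚ)
    (t := s ∪ Set.range (fun j : Fin k => (Pi.single j 1 : Fin k → ℕ))) hsind
    Set.subset_union_left
  have hq : ∀ j : Fin k, qv (Pi.single j 1 : Fin k → ℕ) = Pi.single j 1 := by
    intro j
    ext i
    by_cases h : i = j <;> simp [qv, h]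
  have htop : ⊤ ≤ Submodule.span ℚ (Set.range (fun x : b => qv (x : Fin k → ℕ))) := by
    have h1 : Set.range (fun x : b => qv (x : Fin k → ℕ)) = qv '' b := by
      rw [Set.image_eq_range]
    rw [h1, ← (Pi.basisFun ℚ (Fin k)).span_eq, Submodule.span_le]
    rintro _ ⟨j, rfl⟩
    apply hbspan
    refine ⟨Pi.single j 1, Or.inr ⟨j, rfl⟩, ?_⟩
    rw [hq]; simp
  let B0 := Module.Basis.mk (v := fun x : b => qv (x : Fin k → ℕ)) hbind htop
  let e := B0.indexEquiv (Pi.basisFun ℚ (Fin k))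
  let B := B0.reindex e
  let w : Fin k → Fin k → ℕ := fun j => (e.symm j : Fin k → ℕ)
  have hwinj : Function.Injective w := Subtype.val_injective.comp e.symm.injective
  have hB : ∀ j, B j = qv (w j) := by
    intro j
    rw [Module.Basis.reindex_apply]
    exact Module.Basis.mk_apply hbind htop _
  have hwn : ∀ j i, w j i ≤ n := by
    intro j i
    rcases hbt (e.symm j).2 with h | ⟨l, h⟩
    · exact (le_snorm (hsP h) i).trans hn
    · have : w j = Pi.single l 1 := h.symm
      rw [this, Pi.single_apply]
      split_ifs <;> omega
  let A : Matrix (Fin k) (Fin k) ℤ := Matrix.of fun i j => (w j i : ℤ)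
  let y' : Fin k → ℤ := fun i => (y i : ℤ)
  have hdet : A.det ≠ 0 := by
    have h1 : LinearIndependent ℚ (A.map (Int.cast : ℤ → ℚ)).col := by
      have h0 : (A.map (Int.cast : ℤ → ℚ)).col = B := by
        ext j i
        simp [hB, A, qv]
      rw [h0]
      exact B.linearIndependent
    rw [Matrix.linearIndependent_cols_iff_isUnit, Matrix.isUnit_iff_isUnit_det] at h1
    intro h0
    have h2 : (A.map (Int.cast : ℤ → ℚ)).det = ((A.det : ℤ) : ℚ) := (Int.cast_det A).symm
    rw [h2, h0] at h1
    simp at h1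
  let d := A.cramer y'
  have hcr : ∀ i, ∑ j, (w j i : ℤ) * d j = A.det * y i := by
    intro i
    have := congrFun (A.mulVec_cramer y') i
    simpa [Matrix.mulVec, dotProduct, A, y', d] using this
  have hd0 : ∀ j, w j ∉ s → d j = 0 := by
    intro j hj
    have h1 : ∑ j, (d j : ℚ) • B j = (A.det : ℚ) • qv y := by
      ext i
      have := hcr i
      simp only [Finset.sum_apply, Pi.smul_apply, hB, qv, smul_eq_mul]
      have h : ((∑ j, (w j i : ℤ) * d j : ℤ) : ℚ) = ((A.det * y i : ℤ) : ℚ) := by rw [this]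
      rw [Int.cast_sum, Int.cast_mul] at h
      simp only [Int.cast_mul, Int.cast_natCast] at h
      rw [← h]
      exact Finset.sum_congr rfl fun _ _ => mul_comm _ _
    have h2 : (A.det : ℚ) • qv y ∈ Submodule.span ℚ (B '' {j | w j ∈ s}) := by
      apply Submodule.smul_mem
      have : B '' {j | w j ∈ s} = qv '' s := by
        ext z
        constructor
        · rintro ⟨j, hj, rfl⟩
          exact ⟨w j, hj, (hB j).symm⟩
        · rintro ⟨x, hx, rfl⟩
          refine ⟨e ⟨x, hsb hx⟩, ?_, ?_⟩
          · simpa [w] using hx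
          · rw [hB]; simp [w]
      rw [this]
      exact hspan ⟨y, hyP, rfl⟩
    rw [Module.Basis.mem_span_image, ← h1] at h2
    by_contra hne
    apply hj
    apply h2
    rw [Finset.mem_coe, Finsupp.mem_support_iff, Module.Basis.repr_sum_self]
    exact_mod_cast hne
  have hbd : ∀ j, |(d j : ℝ)| ≤ (k : ℝ) ^ ((k : ℝ) / 2) * (n : ℝ) ^ k := by
    intro j
    simp only [d, Matrix.cramer_apply]
    apply aux_hadamard
    intro i l
    rw [Matrix.updateCol_apply]
    split_ifs
    · simp only [y']
      rw [abs_of_nonneg (by positivity)]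
      exact_mod_cast (le_snorm hyP i).trans hn
    · simp only [A, Matrix.of_apply]
      rw [abs_of_nonneg (by positivity)]
      exact_mod_cast hwn l i
  have hbA : |(A.det : ℝ)| ≤ (k : ℝ) ^ ((k : ℝ) / 2) * (n : ℝ) ^ k := by
    apply aux_hadamard
    intro i l
    simp only [A, Matrix.of_apply]
    rw [abs_of_nonneg (by positivity)]
    exact_mod_cast hwn l i
  let c : (Fin k → ℕ) → ℤ := fun x =>
    if x = y then - A.det else if h : x ∈ s then d (e ⟨x, hsb h⟩) else 0
  refine ⟨c, ⟨y, hyP, by simpa [c] using hdet⟩, ?_, ?_⟩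
  · intro x
    simp only [c]
    split_ifs
    · rw [Int.cast_neg, abs_neg]; exact hbA
    · exact hbd _
    · simp; positivity
  · intro i
    rw [← Finset.add_sum_erase P _ hyP]
    have h1 : ∑ x ∈ P.erase y, c x * (x i : ℤ) = ∑ j, (w j i : ℤ) * d j := by
      have h2 : ∑ j, (w j i : ℤ) * d j
          = ∑ j ∈ Finset.univ.filter (fun j => w j ∈ s), (w j i : ℤ) * d j := by
        symm
        apply Finset.sum_subset (Finset.subset_univ _)
        intro j _ hj
        rw [hd0 j (by simpa using hj), mul_zero]
      have h3 : ∑ j ∈ Finset.univ.filter (fun j => w j ∈ s), (w j i : ℤ) * d j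
          = ∑ x ∈ (Finset.univ.filter (fun j => w j ∈ s)).image w, c x * (x i : ℤ) := by
        rw [Finset.sum_image (fun _ _ _ _ h => hwinj h)]
        apply Finset.sum_congr rfl
        intro j hj
        have hjs : w j ∈ s := by simpa using hj
        have hjy : w j ≠ y := fun h => hys (h ▸ hjs)
        have : c (w j) = d j := by
          simp only [c, if_neg hjy, dif_pos hjs]
          simp [w]
        rw [this, mul_comm]
      rw [h2, h3]
      symm
      apply Finset.sum_subset
      · intro x hx
        obtain ⟨j, hj, rfl⟩ := Finset.mem_image.mp hx
        have hjs : w j ∈ s := by simpa using hj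
        exact Finset.mem_erase.mpr ⟨fun h => hys (h ▸ hjs), hsP hjs⟩
      · intro x hx hx'
        have hxs : x ∉ s := by
          intro h
          apply hx'
          refine Finset.mem_image.mpr ⟨e ⟨x, hsb h⟩, ?_, by simp [w]⟩
          simpa [w] using h
        simp only [c, if_neg (Finset.ne_of_mem_erase hx), dif_neg hxs, zero_mul]
    rw [h1, hcr]
    simp [c]

lemma mem_LSet1 {k : ℕ} {c v : Fin k → ℕ} {P : Finset (Fin k → ℕ)} :
    v ∈ LSet1 c P ↔ ∃ lam : (Fin k → ℕ) → ℕ, v = c + ∑ x ∈ P, lam x • x := by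
  simp [LSet1, LSet]

lemma aux_cover {k : ℕ} (P : Finset (Fin k → ℕ)) (N : ℕ) (c : (Fin k → ℕ) → ℤ)
    (hpos : ∃ x ∈ P, 0 < c x) (hN : ∀ x, c x ≤ N)
    (hc : ∀ i, ∑ x ∈ P, c x * (x i : ℤ) = 0) (x₀ v : Fin k → ℕ) (M : ℕ) :
    ∀ lam : (Fin k → ℕ) → ℕ, v = x₀ + ∑ x ∈ P, lam x • x →
      ∑ x ∈ P.filter (fun x => 0 < c x), lam x ≤ M →
      ∃ x ∈ P, ∃ j < N, v ∈ LSet1 (x₀ + j • x) (P.erase x) := by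
  classical
  induction M with
  | zero =>
    intro lam hv hM
    obtain ⟨x, hx, hcx⟩ := hpos
    have h0 : lam x = 0 := by
      have := Finset.single_le_sum (f := lam) (fun _ _ => Nat.zero_le _)
        (show x ∈ P.filter (fun x => 0 < c x) from Finset.mem_filter.mpr ⟨hx, hcx⟩)
      omega
    refine ⟨x, hx, 0, by have := hN x; omega, ?_⟩
    rw [mem_LSet1]
    refine ⟨lam, ?_⟩
    rw [hv, ← Finset.add_sum_erase P _ hx, h0]
    simp
  | succ M ih =>
    intro lam hv hM
    by_cases hlow : ∃ x ∈ P, (lam x : ℤ) < c x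
    · obtain ⟨x, hx, hl⟩ := hlow
      refine ⟨x, hx, lam x, by have := hN x; omega, ?_⟩
      rw [mem_LSet1]
      refine ⟨lam, ?_⟩
      rw [hv, ← Finset.add_sum_erase P _ hx, add_assoc]
    · push Not at hlow
      have hcast : ∀ x ∈ P, (((lam x : ℤ) - c x).toNat : ℤ) = lam x - c x := by
        intro x hx
        have := hlow x hx
        omega
      refine ih (fun x => ((lam x : ℤ) - c x).toNat) ?_ ?_
      · rw [hv]
        congr 1
        ext i
        have h1 : (∑ x ∈ P, (((lam x : ℤ) - c x).toNat : ℤ) * (x i : ℤ))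
            = ∑ x ∈ P, (lam x : ℤ) * (x i : ℤ) := by
          rw [← sub_zero (∑ x ∈ P, (lam x : ℤ) * (x i : ℤ)), ← hc i, ← Finset.sum_sub_distrib]
          apply Finset.sum_congr rfl
          intro x hx
          rw [hcast x hx]; ring
        simp only [Finset.sum_apply, Pi.smul_apply, smul_eq_mul]
        exact_mod_cast h1.symm
      · apply Nat.le_of_lt_succ
        refine lt_of_lt_of_le ?_ hM
        obtain ⟨x, hx, hcx⟩ := hpos
        apply Finset.sum_lt_sum
        · intro z hz
          have := (Finset.mem_filter.mp hz).2
          have := hlow z (Finset.mem_filter.mp hz).1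
          omega
        · refine ⟨x, Finset.mem_filter.mpr ⟨hx, hcx⟩, ?_⟩
          have := hlow x hx
          omega

lemma aux_sub {k : ℕ} (P : Finset (Fin k → ℕ)) (x₀ x : Fin k → ℕ) (hx : x ∈ P) (j : ℕ) :
    LSet1 (x₀ + j • x) (P.erase x) ⊆ LSet1 x₀ P := by
  classical
  intro v hv
  rw [mem_LSet1] at hv ⊢
  obtain ⟨lam, rfl⟩ := hv
  refine ⟨fun z => if z = x then j else lam z, ?_⟩
  rw [← Finset.add_sum_erase P _ hx, add_assoc]
  congr 2
  · simp
  · apply Finset.sum_congr rfl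
    intro z hz
    simp [Finset.ne_of_mem_erase hz]

lemma vnorm_step {k : ℕ} (P : Finset (Fin k → ℕ)) (n N j : ℕ) (hn : snorm P ≤ n) (hj : j < N)
    (x₀ x : Fin k → ℕ) (hx : x ∈ P) : vnorm (x₀ + j • x) ≤ vnorm x₀ + N * n := by
  apply Finset.sup_le
  intro i _
  have h1 : x₀ i ≤ vnorm x₀ := Finset.le_sup (f := x₀) (Finset.mem_univ i)
  have h2 : j * x i ≤ N * n := Nat.mul_le_mul hj.le ((le_snorm hx i).trans hn)
  simp only [Pi.add_apply, Pi.smul_apply, smul_eq_mul]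
  omega

lemma linIndep_empty {k : ℕ} : LinIndep (∅ : Finset (Fin k → ℕ)) := by
  unfold LinIndep
  apply linearIndependent_empty_type

lemma aux_zero {k : ℕ} (P : Finset (Fin k → ℕ)) (x₀ : Fin k → ℕ) (h : ∀ x ∈ P, x = 0) :
    LSet1 x₀ ∅ = LSet1 x₀ P := by
  ext v
  rw [mem_LSet1, mem_LSet1]
  have h0 : ∀ lam : (Fin k → ℕ) → ℕ, ∑ x ∈ P, lam x • x = 0 := by
    intro lam
    apply Finset.sum_eq_zero
    intro x hx
    rw [h x hx, smul_zero]
  simp only [h0, Finset.sum_empty]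

lemma linIndep_singleton {k : ℕ} (x : Fin k → ℕ) (hx : x ≠ 0) : LinIndep {x} := by
  unfold LinIndep
  have : Unique ({x} : Finset (Fin k → ℕ)) := ⟨⟨⟨x, by simp⟩⟩, fun ⟨y, hy⟩ => by
    simpa using hy⟩
  apply LinearIndependent.of_subsingleton ⟨x, by simp⟩
  intro h
  apply hx
  ext i
  have := congrFun h i
  simpa using this

lemma aux_main {k n N : ℕ} (hN1 : 1 ≤ N)
    (hrel : ∀ P : Finset (Fin k → ℕ), snorm P ≤ n → ¬ LinIndep P →
      ∃ c : (Fin k → ℕ) → ℤ, (∃ x ∈ P, 0 < c x) ∧ (∀ x, c x ≤ N) ∧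
        ∀ i, ∑ x ∈ P, c x * (x i : ℤ) = 0) (m : ℕ) :
    ∀ (P : Finset (Fin k → ℕ)) (x₀ : Fin k → ℕ), P.card = m → snorm P ≤ n →
      ∃ J : Finset ((Fin k → ℕ) × Finset (Fin k → ℕ)),
        J.card ≤ m.factorial * N ^ (m - 1) ∧
        (∀ p ∈ J, LinIndep p.2 ∧ snorm p.2 ≤ n ∧ vnorm p.1 ≤ vnorm x₀ + m * (N * n)) ∧
        (⋃ p ∈ J, LSet1 p.1 p.2) = LSet1 x₀ P := by
  classical
  induction m with
  | zero =>
    intro P x₀ hP hPn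
    rw [Finset.card_eq_zero] at hP
    subst hP
    exact ⟨{(x₀, ∅)}, by simp, by simp [linIndep_empty, hPn], by simp⟩
  | succ m ih =>
    intro P x₀ hP hPn
    by_cases hind : LinIndep P
    · refine ⟨{(x₀, P)}, ?_, by simp [hind, hPn], by simp⟩
      rw [Finset.card_singleton]
      exact Nat.mul_pos (Nat.factorial_pos _) (pow_pos hN1 _)
    rcases Nat.eq_zero_or_pos m with rfl | hm
    · obtain ⟨x, rfl⟩ := Finset.card_eq_one.mp hP
      have hx : x = 0 := by
        by_contra h
        exact hind (linIndep_singleton x h)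
      refine ⟨{(x₀, ∅)}, by simp, by simp [linIndep_empty, snorm], ?_⟩
      simpa using aux_zero {x} x₀ (by simpa using hx)
    obtain ⟨c, hpos, hcN, hc⟩ := hrel P hPn hind
    have hers : ∀ x, snorm (P.erase x) ≤ n := fun x =>
      (Finset.sup_mono (Finset.erase_subset x P)).trans hPn
    have hex : ∀ q : (Fin k → ℕ) × ℕ, ∃ J : Finset ((Fin k → ℕ) × Finset (Fin k → ℕ)),
        q.1 ∈ P →
        J.card ≤ m.factorial * N ^ (m - 1) ∧
        (∀ p ∈ J, LinIndep p.2 ∧ snorm p.2 ≤ n ∧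
          vnorm p.1 ≤ vnorm (x₀ + q.2 • q.1) + m * (N * n)) ∧
        (⋃ p ∈ J, LSet1 p.1 p.2) = LSet1 (x₀ + q.2 • q.1) (P.erase q.1) := by
      intro q
      by_cases hq : q.1 ∈ P
      · obtain ⟨J, hJ⟩ := ih (P.erase q.1) (x₀ + q.2 • q.1)
          (by rw [Finset.card_erase_of_mem hq, hP]; rfl) (hers _)
        exact ⟨J, fun _ => hJ⟩
      · exact ⟨∅, fun h => absurd h hq⟩
    choose J hJ using hex
    refine ⟨(P ×ˢ Finset.range N).biUnion J, ?_, ?_, ?_⟩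
    · refine (Finset.card_biUnion_le_card_mul _ _ (m.factorial * N ^ (m - 1)) ?_).trans ?_
      · intro q hq
        exact (hJ q (Finset.mem_product.mp hq).1).1
      · rw [Finset.card_product, Finset.card_range, hP, Nat.factorial_succ]
        obtain ⟨l, rfl⟩ : ∃ l, m = l + 1 := ⟨m - 1, by omega⟩
        simp only [Nat.add_sub_cancel]
        apply le_of_eq
        ring
    · intro p hp
      obtain ⟨q, hq, hpq⟩ := Finset.mem_biUnion.mp hp
      have hq' := Finset.mem_product.mp hq
      obtain ⟨h1, h2, h3⟩ := (hJ q hq'.1).2.1 p hpq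
      refine ⟨h1, h2, h3.trans ?_⟩
      have := vnorm_step P n N q.2 hPn (Finset.mem_range.mp hq'.2) x₀ q.1 hq'.1
      rw [Nat.add_mul]
      omega
    · apply Set.Subset.antisymm
      · intro v hv
        simp only [Set.mem_iUnion] at hv
        obtain ⟨p, hp, hv⟩ := hv
        obtain ⟨q, hq, hpq⟩ := Finset.mem_biUnion.mp hp
        have hq' := Finset.mem_product.mp hq
        apply aux_sub P x₀ q.1 hq'.1 q.2
        rw [← (hJ q hq'.1).2.2]
        simp only [Set.mem_iUnion]
        exact ⟨p, hpq, hv⟩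
      · intro v hv
        obtain ⟨lam, hlam⟩ := mem_LSet1.mp hv
        obtain ⟨x, hx, j, hj, hvj⟩ := aux_cover P N c hpos hcN hc x₀ v _ lam hlam le_rfl
        rw [← (hJ (x, j) hx).2.2] at hvj
        simp only [Set.mem_iUnion] at hvj ⊢
        obtain ⟨p, hp, hv⟩ := hvj
        exact ⟨p, Finset.mem_biUnion.mpr ⟨(x, j),
          Finset.mem_product.mpr ⟨hx, Finset.mem_range.mpr hj⟩, hp⟩, hv⟩

lemma two_pow_le_fact (m : ℕ) : 2 ^ m ≤ (m + 1).factorial := by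
  induction m with
  | zero => simp
  | succ m ih =>
    rw [Nat.factorial_succ, pow_succ, mul_comm]
    exact Nat.mul_le_mul (by omega) ih

lemma aux_index {k : ℕ} (J : Finset ((Fin k → ℕ) × Finset (Fin k → ℕ))) :
    ∃ (I : Finset ℕ) (f : ℕ → (Fin k → ℕ) × Finset (Fin k → ℕ)),
      I.card = J.card ∧ (∀ i ∈ I, f i ∈ J) ∧ (∀ p ∈ J, ∃ i ∈ I, f i = p) := by
  classical
  obtain ⟨g, hg⟩ := Countable.exists_injective_nat ((Fin k → ℕ) × Finset (Fin k → ℕ))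
  refine ⟨J.image g, Function.invFun g, Finset.card_image_of_injective _ hg, ?_, ?_⟩
  · intro i hi
    obtain ⟨p, hp, rfl⟩ := Finset.mem_image.mp hi
    rwa [Function.leftInverse_invFun hg]
  · intro p hp
    exact ⟨g p, Finset.mem_image_of_mem g hp, Function.leftInverse_invFun hg p⟩

lemma aux_J {k : ℕ} (hk : 1 ≤ k) (x₀ : Fin k → ℕ)
    (P : Finset (Fin k → ℕ)) (m n : ℕ)
    (hm : m = P.card) (hn : n = snorm P) :
    ∃ J : Finset ((Fin k → ℕ) × Finset (Fin k → ℕ)),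
      (J.card : ℝ) ≤ (Nat.factorial (m + 1) : ℝ) * (Nat.factorial m : ℝ) / 2 ^ m *
        ((k : ℝ) ^ ((k : ℝ) / 2) * (n : ℝ) ^ k + 1) ^ (m - 1) ∧
      (∀ p ∈ J, LinIndep p.2 ∧ snorm p.2 ≤ n ∧
        (vnorm p.1 : ℝ) ≤ (vnorm x₀ : ℝ) +
          ((m : ℝ) + 1) * ((m : ℝ) + 2) / 2 * (k : ℝ) ^ ((k : ℝ) / 2) * (n : ℝ) ^ (k + 1)) ∧
      (⋃ p ∈ J, LSet1 p.1 p.2) = LSet1 x₀ P := by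
  have hK : (0 : ℝ) ≤ (k : ℝ) ^ ((k : ℝ) / 2) := by positivity
  have hK1 : (1 : ℝ) ≤ (k : ℝ) ^ ((k : ℝ) / 2) :=
    Real.one_le_rpow (by exact_mod_cast hk) (by positivity)
  have hfac : (Nat.factorial m : ℝ) ≤
      (Nat.factorial (m + 1) : ℝ) * (Nat.factorial m : ℝ) / 2 ^ m := by
    rw [le_div_iff₀ (by positivity), mul_comm]
    gcongr
    exact_mod_cast two_pow_le_fact m
  rcases Nat.eq_zero_or_pos n with h0 | hn1
  · refine ⟨{(x₀, ∅)}, ?_, ?_, ?_⟩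
    · have h1 : (1 : ℝ) ≤ Nat.factorial m := by exact_mod_cast Nat.factorial_pos m
      have h2 : (1 : ℝ) ≤ ((k : ℝ) ^ ((k : ℝ) / 2) * (n : ℝ) ^ k + 1) ^ (m - 1) :=
        one_le_pow₀ (by have : 0 ≤ (k : ℝ) ^ ((k : ℝ) / 2) * (n : ℝ) ^ k := by positivity
                        linarith)
      rw [Finset.card_singleton, Nat.cast_one]
      calc (1 : ℝ) = 1 * 1 := by ring
        _ ≤ _ := mul_le_mul (h1.trans hfac) h2 zero_le_one (zero_le_one.trans (h1.trans hfac))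
    · intro p hp
      rw [Finset.mem_singleton] at hp
      subst hp
      refine ⟨linIndep_empty, by simp [snorm], ?_⟩
      have : 0 ≤ ((m : ℝ) + 1) * ((m : ℝ) + 2) / 2 * (k : ℝ) ^ ((k : ℝ) / 2) * (n : ℝ) ^ (k + 1) := by
        positivity
      simp only
      linarith
    · have := aux_zero P x₀ (by
        intro x hx
        ext i
        have := le_snorm hx i
        simp only [Pi.zero_apply]
        omega)
      simpa using this
  · set D : ℝ := (k : ℝ) ^ ((k : ℝ) / 2) * (n : ℝ) ^ k with hD
    have hn1' : (1 : ℝ) ≤ n := by exact_mod_cast hn1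
    have hD1 : 1 ≤ D := one_le_mul_of_one_le_of_one_le hK1 (one_le_pow₀ hn1')
    have hN1 : 1 ≤ ⌊D⌋₊ := by rwa [Nat.one_le_floor_iff]
    have hND : (⌊D⌋₊ : ℝ) ≤ D := Nat.floor_le (by linarith)
    obtain ⟨J, hJ1, hJ2, hJ3⟩ := aux_main (k := k) (n := n) (N := ⌊D⌋₊) hN1 (by
      intro Q hQ hQi
      obtain ⟨c, ⟨x, hx, hcx⟩, hcb, hc⟩ := aux_relation Q n hQ hn1 hQi
      have hcb' : ∀ z, |c z| ≤ (⌊D⌋₊ : ℤ) := by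
        intro z
        have h1 := hcb z
        rw [← hD] at h1
        have h2 : (((c z).natAbs : ℕ) : ℝ) ≤ D := by
          rwa [Nat.cast_natAbs, Int.cast_abs]
        have := Nat.le_floor h2
        rw [Int.abs_eq_natAbs]
        exact_mod_cast this
      rcases lt_or_gt_of_ne hcx with h | h
      · refine ⟨fun z => - c z, ⟨x, hx, by simpa using h⟩, ?_, ?_⟩
        · intro z
          exact (neg_le_abs _).trans (hcb' z)
        · intro i
          have := hc i
          simp only [neg_mul, Finset.sum_neg_distrib]
          omega
      · exact ⟨c, ⟨x, hx, h⟩, fun z => (le_abs_self _).trans (hcb' z), hc⟩) m P x₀ hm.symm hn.ge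
    refine ⟨J, ?_, ?_, hJ3⟩
    · have h1 : (J.card : ℝ) ≤ (m.factorial : ℝ) * (⌊D⌋₊ : ℝ) ^ (m - 1) := by exact_mod_cast hJ1
      refine h1.trans ?_
      gcongr
      linarith
    · intro p hp
      obtain ⟨h1, h2, h3⟩ := hJ2 p hp
      refine ⟨h1, h2, ?_⟩
      have h4 : (vnorm p.1 : ℝ) ≤ vnorm x₀ + m * ((⌊D⌋₊ : ℝ) * n) := by exact_mod_cast h3
      refine h4.trans ?_
      have h5 : ((m : ℝ) + 1) * ((m : ℝ) + 2) / 2 * (k : ℝ) ^ ((k : ℝ) / 2) * (n : ℝ) ^ (k + 1)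
          = ((m : ℝ) + 1) * ((m : ℝ) + 2) / 2 * (D * n) := by
        rw [hD, pow_succ]; ring
      rw [h5]
      have hm0 : (0 : ℝ) ≤ m := by positivity
      gcongr
      nlinarith

/-- Decomposition of a linear set into a union of linear sets with linearly
independent period sets. -/
theorem linear_to_indep (k : ℕ) (hk : 1 ≤ k) (x₀ : Fin k → ℕ)
    (P : Finset (Fin k → ℕ)) (m n : ℕ)
    (hm : m = P.card) (hn : n = snorm P) :
    ∃ (I : Finset ℕ) (x : ℕ → (Fin k → ℕ)) (P' : ℕ → Finset (Fin k → ℕ)),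
      (I.card : ℝ) ≤ (Nat.factorial (m + 1) : ℝ) * (Nat.factorial m : ℝ) / 2 ^ m *
        ((k : ℝ) ^ ((k : ℝ) / 2) * (n : ℝ) ^ k + 1) ^ (m - 1) ∧
      (∀ i ∈ I, LinIndep (P' i) ∧ snorm (P' i) ≤ n ∧
        (vnorm (x i) : ℝ) ≤ (vnorm x₀ : ℝ) +
          ((m : ℝ) + 1) * ((m : ℝ) + 2) / 2 * (k : ℝ) ^ ((k : ℝ) / 2) * (n : ℝ) ^ (k + 1)) ∧
      (⋃ i ∈ I, LSet1 (x i) (P' i)) = LSet1 x₀ P := by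

  obtain ⟨J, hJ1, hJ2, hJ3⟩ := aux_J hk x₀ P m n hm hn
  obtain ⟨I, f, hI1, hI2, hI3⟩ := aux_index J
  refine ⟨I, fun i => (f i).1, fun i => (f i).2, ?_, ?_, ?_⟩
  · rw [hI1]; exact hJ1
  · intro i hi
    exact hJ2 (f i) (hI2 i hi)
  · rw [← hJ3]
    ext v
    simp only [Set.mem_iUnion]
    constructor
    · rintro ⟨i, hi, hv⟩
      exact ⟨f i, hI2 i hi, hv⟩
    · rintro ⟨p, hp, hv⟩
      obtain ⟨i, hi, rfl⟩ := hI3 p hp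
      exact ⟨i, hi, hv⟩
end
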